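/- For every nonnegative integer n, the number of diagonal-lattice walks of length 2n that start at (0,0), end at (0,0), and are confined to the three-quadrant cone C equals (16^n / 9) · ( 3 · ((1/2)_n)² / ((2)_n)² + 8 · (1/2)_n (7/6)_n / ( (2)_n (4/3)_n ) − 2 · (1/2)_n (5/6)_n / ( (2)_n (5/3)_n ) ). -/

import Mathlib

/-- Square-lattice steps. -/
def squareSteps : Set (ℤ × ℤ) := {(1,0), (-1,0), (0,1), (0,-1)}

/-- Diagonal-lattice steps. -/
def diagSteps : Set (ℤ × ℤ) := {(1,1), (1,-1), (-1,1), (-1,-1)}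

/-- The three-quadrant cone `C = {(i,j) : i ≥ 0 or j ≥ 0}`. -/
def coneC : Set (ℤ × ℤ) := {p | 0 ≤ p.1 ∨ 0 ≤ p.2}

/-- The quadrant `Q = {(i,j) : i ≥ 0 and j ≥ 0}`. -/
def quadQ : Set (ℤ × ℤ) := {p | 0 ≤ p.1 ∧ 0 ≤ p.2}

/-- Number of walks of length `n` with steps in `steps`, from `a` to `b`,
confined to `region`. -/
noncomputable def walkCount (steps region : Set (ℤ × ℤ)) (a b : ℤ × ℤ) (n : ℕ) : ℕ :=
  Nat.card {w : Fin (n+1) → ℤ × ℤ //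
    w 0 = a ∧ w (Fin.last n) = b ∧
    (∀ k : Fin n, w k.succ - w k.castSucc ∈ steps) ∧
    (∀ k, w k ∈ region)}

/-- Ascending factorial (Pochhammer symbol) `(a)ₙ = a(a+1)⋯(a+n-1)`. -/
noncomputable def poch (a : ℚ) (n : ℕ) : ℚ := (ascPochhammer ℚ n).eval a

theorem trace_identity {K : Type*} [Field K] {μ k u₁ u₂ u₃ : K}
    (h₁ : k * u₁ * (1 + μ * u₁) ^ 2 = (1 + u₁) ^ 2)
    (h₂ : k * u₂ * (1 + μ * u₂) ^ 2 = (1 + u₂) ^ 2)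
    (h₃ : u₃ * (1 + μ * u₃) ^ 2 = μ * k * (1 + u₃) ^ 2)
    (hμ : μ ≠ 0) (hu₃ : u₃ ≠ 0)
    (h₁₂ : u₁ ≠ u₂) (h₁₃ : μ * u₁ * u₃ ≠ 1) (h₂₃ : μ * u₂ * u₃ ≠ 1)
    (a₁ : 1 + u₁ ≠ 0) (a₂ : 1 + u₂ ≠ 0) (a₃ : 1 + u₃ ≠ 0)
    (b₁ : 1 + μ * u₁ ≠ 0) (b₂ : 1 + μ * u₂ ≠ 0) (b₃ : 1 + μ * u₃ ≠ 0) :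
    (1 - μ * u₁ ^ 2) / ((1 + μ * u₁) * (1 + u₁)) + (1 - μ * u₂ ^ 2) / ((1 + μ * u₂) * (1 + u₂))
      = (1 - μ * u₃ ^ 2) / ((1 + μ * u₃) * (1 + u₃)) := by
  obtain ⟨w, hw⟩ : ∃ w, μ * u₃ * w = 1 := ⟨(μ * u₃)⁻¹, by field_simp⟩
  have hw0 : w ≠ 0 := by rintro rfl; simp at hw
  have hw3 : k * w * (1 + μ * w) ^ 2 = (1 + w) ^ 2 := by
    have e : u₃ = 1 / (μ * w) := by field_simp; linear_combination hw
    rw [e] at h₃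
    field_simp at h₃
    linear_combination -h₃
  have h13 : u₁ ≠ w := by rintro rfl; apply h₁₃; linear_combination hw
  have h23 : u₂ ≠ w := by rintro rfl; apply h₂₃; linear_combination hw
  have d12 : k * (1 + 2 * μ * (u₁ + u₂) + μ ^ 2 * (u₁ ^ 2 + u₁ * u₂ + u₂ ^ 2)) = u₁ + u₂ + 2 := by
    apply mul_left_cancel₀ (sub_ne_zero.2 h₁₂); linear_combination h₁ - h₂
  have d13 : k * (1 + 2 * μ * (u₁ + w) + μ ^ 2 * (u₁ ^ 2 + u₁ * w + w ^ 2)) = u₁ + w + 2 := by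
    apply mul_left_cancel₀ (sub_ne_zero.2 h13); linear_combination h₁ - hw3
  have e1 : k * (2 * μ + μ ^ 2 * (u₁ + u₂ + w)) = 1 := by
    apply mul_left_cancel₀ (sub_ne_zero.2 h23); linear_combination d12 - d13
  have e2 : k * μ ^ 2 * (u₁ * u₂ + u₁ * w + u₂ * w) = k - 2 := by
    linear_combination (u₁ + u₂) * e1 - d12
  have e3 : k * μ ^ 2 * (u₁ * u₂ * w) = 1 := by
    linear_combination h₁ - u₁ ^ 2 * e1 + u₁ * e2
  have hk : k ≠ 0 := by rintro rfl; simp at e3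
  have h3' : (1 - μ * u₃ ^ 2) / ((1 + μ * u₃) * (1 + u₃))
      = - ((1 - μ * w ^ 2) / ((1 + μ * w) * (1 + w))) := by
    have e : w = 1 / (μ * u₃) := by field_simp; linear_combination hw
    have : μ * u₃ + 1 ≠ 0 := by convert b₃ using 1; ring
    have : u₃ + 1 ≠ 0 := by convert a₃ using 1; ring
    rw [e]; field_simp; ring
  have aw : 1 + w ≠ 0 := by
    intro h; apply b₃
    linear_combination μ * u₃ * h - hw
  have bw : 1 + μ * w ≠ 0 := by
    intro h; apply a₃
    linear_combination u₃ * h - hw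
  have ea : u₁ + u₂ + w = u₁ * u₂ * w - 2 / μ := by
    field_simp
    apply mul_left_cancel₀ (mul_ne_zero hk hμ); linear_combination e1 - e3
  have eb : u₁ * u₂ + u₁ * w + u₂ * w = 1 / μ ^ 2 - 2 * (u₁ * u₂ * w) := by
    field_simp
    apply mul_left_cancel₀ hk; linear_combination e2 + 2 * e3
  have hN : (1 - μ * u₁ ^ 2) * ((1 + μ * u₂) * (1 + u₂)) * ((1 + μ * w) * (1 + w))
      + (1 - μ * u₂ ^ 2) * ((1 + μ * u₁) * (1 + u₁)) * ((1 + μ * w) * (1 + w))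
      + (1 - μ * w ^ 2) * ((1 + μ * u₁) * (1 + u₁)) * ((1 + μ * u₂) * (1 + u₂)) = 0 := by
    have : ∀ a b c : K, a = c - 2 / μ → b = 1 / μ ^ 2 - 2 * c →
        3 + 2 * (1 + μ) * a + μ * (a ^ 2 - 2 * b) + (1 + μ) ^ 2 * b - μ ^ 2 * (b ^ 2 - 2 * a * c)
          - μ * (1 + μ) ^ 2 * a * c - 2 * (1 + μ) * μ ^ 2 * b * c - 3 * μ ^ 3 * c ^ 2 = 0 := by
      rintro a b c rfl rfl
      field_simp
      ring
    rw [← this _ _ _ ea eb]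
    ring
  rw [h3', ← add_eq_zero_iff_eq_neg]
  field_simp
  linear_combination hN

/-- The numerator of the parametrised boundary generating function. -/
def rowNum {A : Type*} [CommRing A] (θ η : A) : A :=
  (1 - 2 * θ + θ ^ 2 - θ ^ 3 - θ ^ 5)
    + (2 * θ ^ 2 - 7 * θ ^ 3 + 13 * θ ^ 4 - 18 * θ ^ 5 + 9 * θ ^ 6 - 4 * θ ^ 7 - 2 * θ ^ 8 + θ ^ 9)
      * η ^ 2
    + (θ ^ 5 - 2 * θ ^ 6 - 4 * θ ^ 7 + 9 * θ ^ 8 - 18 * θ ^ 9 + 13 * θ ^ 10 - 7 * θ ^ 11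
      + 2 * θ ^ 12) * η ^ 4
    + (- θ ^ 9 - θ ^ 11 + θ ^ 12 - 2 * θ ^ 13 + θ ^ 14) * η ^ 6

theorem param_cubic {K : Type*} [Field K] {θ z η δ r A C D P Q u μ : K}
    (hδ : δ = 1 - θ + θ ^ 2) (hr : r = 1 + θ) (hA : A = 1 + θ * δ * η ^ 2)
    (hC : C = δ + θ ^ 3 * η ^ 2) (hD : D = 1 + θ ^ 2 * η ^ 2) (hP : P = 1 + η ^ 2)
    (hQ : Q = 1 + θ ^ 4 * η ^ 2) (hz : η * C = z * A)
    (hu : u = (1 - θ ^ 2) ^ 2 * η ^ 2 / D ^ 2) (hμ : μ = θ * (1 - θ) ^ 2 / (δ * r ^ 2))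
    (hη0 : η ≠ 0) (hδ0 : δ ≠ 0) (hr0 : r ≠ 0) (hA0 : A ≠ 0) (hC0 : C ≠ 0) (hD0 : D ≠ 0) :
    1 + u = P * Q / D ^ 2 ∧ 1 + μ * u = A * C / (δ * D ^ 2) ∧ 1 + z ^ 2 = P * D * Q / A ^ 2 ∧
    z + z⁻¹ = P * D * Q / (η * A * C) ∧
    (z + z⁻¹) ^ 2 * u * (1 + μ * u) ^ 2 = (1 - θ ^ 2) ^ 2 / δ ^ 2 * (1 + u) ^ 2 := by
  have hz' : z = η * C / A := by rw [eq_div_iff hA0, hz]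
  have e1 : 1 + u = P * Q / D ^ 2 := by
    rw [hu]; field_simp; rw [hD, hP, hQ]; ring
  have e2 : 1 + μ * u = A * C / (δ * D ^ 2) := by
    rw [hu, hμ]; field_simp; rw [hD, hA, hC, hr, hδ]; ring
  have e3 : A ^ 2 + η ^ 2 * C ^ 2 = P * D * Q := by
    rw [hD, hA, hC, hP, hQ, hδ]; ring
  have e4 : z + z⁻¹ = P * D * Q / (η * A * C) := by
    rw [hz', ← e3]; field_simp; ring
  refine ⟨e1, e2, ?_, e4, ?_⟩
  · rw [hz', ← e3]; field_simp
  · rw [e1, e2, e4, hu]; field_simp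

theorem param_value {K : Type*} [Field K] {θ z η δ r A C D P Q u μ R : K}
    (h3 : (3 : K) ≠ 0) (hδ : δ = 1 - θ + θ ^ 2) (hr : r = 1 + θ) (hA : A = 1 + θ * δ * η ^ 2)
    (hC : C = δ + θ ^ 3 * η ^ 2) (hD : D = 1 + θ ^ 2 * η ^ 2) (hP : P = 1 + η ^ 2)
    (hQ : Q = 1 + θ ^ 4 * η ^ 2) (hz : η * C = z * A)
    (hu : u = (1 - θ ^ 2) ^ 2 * η ^ 2 / D ^ 2) (hμ : μ = θ * (1 - θ) ^ 2 / (δ * r ^ 2))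
    (hη0 : η ≠ 0) (hδ0 : δ ≠ 0) (hr0 : r ≠ 0) (hA0 : A ≠ 0) (hC0 : C ≠ 0) (hD0 : D ≠ 0)
    (hP0 : P ≠ 0) (hQ0 : Q ≠ 0) (hθ : θ ≠ 0)
    (hR : 3 * δ ^ 3 * D ^ 2 * Q ^ 2 * R = η * (1 + θ) ^ 3 * (1 - θ) *
      rowNum θ η) :
    (z + z⁻¹) * R = r ^ 6 * (1 - θ) ^ 2 / (3 * θ * δ ^ 3) / (1 + z ^ 2)
      - (1 - θ - θ ^ 2 - θ ^ 3) * r ^ 3 * (1 - θ) / (3 * δ ^ 3)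
      - (1 + θ ^ 2) ^ 2 * r ^ 3 * (1 - θ) / (3 * θ * δ ^ 3) *
        ((1 - μ * u ^ 2) / ((1 + μ * u) * (1 + u))) := by
  obtain ⟨e1, e2, e3, e4, -⟩ := param_cubic hδ hr hA hC hD hP hQ hz hu hμ hη0 hδ0 hr0 hA0 hC0 hD0
  have e5 : 1 - μ * u ^ 2 = (δ * D ^ 4 - θ * (1 - θ) ^ 6 * r ^ 2 * η ^ 4) / (δ * D ^ 4) := by
    rw [hu, hμ, show 1 - θ ^ 2 = r * (1 - θ) by rw [hr]; ring]; field_simp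
  have e6 : R = η * r ^ 3 * (1 - θ) * rowNum θ η /
        (3 * δ ^ 3 * D ^ 2 * Q ^ 2) := by
    rw [eq_div_iff (mul_ne_zero (mul_ne_zero (mul_ne_zero h3 (pow_ne_zero _ hδ0))
      (pow_ne_zero _ hD0)) (pow_ne_zero _ hQ0)), hr]; linear_combination hR
  have key : θ * P ^ 2 * rowNum θ η =
      r ^ 3 * (1 - θ) * A ^ 3 * C - (1 - θ - θ ^ 2 - θ ^ 3) * θ * A * C * P * D * Q
        - (1 + θ ^ 2) ^ 2 * D * (δ * D ^ 4 - θ * (1 - θ) ^ 6 * r ^ 2 * η ^ 4) := by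
    rw [rowNum, hP, hr, hA, hC, hD, hQ, hδ]; ring
  generalize rowNum θ η = q at *
  rw [e4, e5, e6, e3, e2, e1]
  generalize δ * D ^ 4 - θ * (1 - θ) ^ 6 * r ^ 2 * η ^ 4 = W at *
  field_simp
  have := congrArg (fun x => (1 - θ) * x) key
  linear_combination this

/-- `η` parametrises `z`, and `R` is the corresponding value of the boundary generating function. -/
structure IsParam {K : Type*} [Field K] (θ z η R : K) : Prop where
  curve : η * (1 - θ + θ ^ 2 + θ ^ 3 * η ^ 2) = z * (1 + θ * (1 - θ + θ ^ 2) * η ^ 2)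
  value : 3 * (1 - θ + θ ^ 2) ^ 3 * (1 + θ ^ 2 * η ^ 2) ^ 2 * (1 + θ ^ 4 * η ^ 2) ^ 2 * R =
    η * (1 + θ) ^ 3 * (1 - θ) * rowNum θ η
  ne_zero : η ≠ 0
  ne_zero₁ : 1 + θ * (1 - θ + θ ^ 2) * η ^ 2 ≠ 0
  ne_zero₂ : 1 - θ + θ ^ 2 + θ ^ 3 * η ^ 2 ≠ 0
  ne_zero₃ : 1 + θ ^ 2 * η ^ 2 ≠ 0
  ne_zero₄ : 1 + η ^ 2 ≠ 0
  ne_zero₅ : 1 + θ ^ 4 * η ^ 2 ≠ 0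

theorem param_cubic_reciprocal {K : Type*} [Field K] {B s σ t μ u : K} (hB : B ≠ 0)
    (h : σ * (t * s) = 1) (hμ : B ^ 2 * t ^ 2 = μ)
    (hu : σ ^ 2 * u * (1 + μ * u) ^ 2 = B * (1 + u) ^ 2) :
    u * (1 + μ * u) ^ 2 = μ * (s ^ 2 / B) * (1 + u) ^ 2 := by
  have e : (σ * (t * s)) ^ 2 = 1 := by rw [h, one_pow]
  have hk : s ^ 2 / B * B = s ^ 2 := div_mul_cancel₀ _ hB
  apply mul_left_cancel₀ hB
  generalize s ^ 2 / B = k at *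
  linear_combination (B * (t * s) ^ 2) * hu - B * u * (1 + μ * u) ^ 2 * e
    + s ^ 2 * (1 + u) ^ 2 * hμ - μ * (1 + u) ^ 2 * hk

theorem IsParam.kernel_identity {K : Type*} [Field K] {θ t x Y η₁ η₂ η₃ R₁ R₂ R₃ : K}
    (h3 : (3 : K) ≠ 0)
    (h₁ : IsParam θ x η₁ R₁) (h₂ : IsParam θ x⁻¹ η₂ R₂) (h₃ : IsParam θ Y η₃ R₃)
    (ht : t ^ 2 * (1 + θ) ^ 6 * (1 - θ) ^ 2 = θ * (1 - θ + θ ^ 2) ^ 3)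
    (hY : Y = t * (x + x⁻¹) * (1 + Y ^ 2))
    (ht0 : t ≠ 0) (hx0 : x ≠ 0) (hs0 : x + x⁻¹ ≠ 0) (hY0 : Y ≠ 0)
    (hθ0 : θ ≠ 0) (hr0 : 1 + θ ≠ 0) (hθ1 : 1 - θ ≠ 0) (hδ0 : 1 - θ + θ ^ 2 ≠ 0)
    (h12 : η₁ ^ 2 * (1 + θ ^ 2 * η₂ ^ 2) ^ 2 ≠ η₂ ^ 2 * (1 + θ ^ 2 * η₁ ^ 2) ^ 2)
    (h13 : θ * (1 - θ) ^ 2 * (1 - θ ^ 2) ^ 4 * η₁ ^ 2 * η₃ ^ 2 ≠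
      (1 - θ + θ ^ 2) * (1 + θ) ^ 2 * (1 + θ ^ 2 * η₁ ^ 2) ^ 2 * (1 + θ ^ 2 * η₃ ^ 2) ^ 2)
    (h23 : θ * (1 - θ) ^ 2 * (1 - θ ^ 2) ^ 4 * η₂ ^ 2 * η₃ ^ 2 ≠
      (1 - θ + θ ^ 2) * (1 + θ) ^ 2 * (1 + θ ^ 2 * η₂ ^ 2) ^ 2 * (1 + θ ^ 2 * η₃ ^ 2) ^ 2) :
    (x + x⁻¹) * (R₁ + R₂) = (1 + Y ^ 2) * (R₃ / Y) + (x + x⁻¹) ^ 2 * (1 + Y ^ 2) / 3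
      - (1 - θ - θ ^ 2 - θ ^ 3) * (1 + θ) ^ 3 * (1 - θ) / (3 * (1 - θ + θ ^ 2) ^ 3) := by
  obtain ⟨c₁, v₁, n₁, a₁, b₁, d₁, p₁, q₁⟩ := h₁
  obtain ⟨c₂, v₂, n₂, a₂, b₂, d₂, p₂, q₂⟩ := h₂
  obtain ⟨c₃, v₃, n₃, a₃, b₃, d₃, p₃, q₃⟩ := h₃
  have w₁ := param_value h3 rfl rfl rfl rfl rfl rfl rfl c₁ rfl rfl n₁ hδ0 hr0 a₁ b₁ d₁ p₁ q₁ hθ0 v₁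
  have w₂ := param_value h3 rfl rfl rfl rfl rfl rfl rfl c₂ rfl rfl n₂ hδ0 hr0 a₂ b₂ d₂ p₂ q₂ hθ0 v₂
  have w₃ := param_value h3 rfl rfl rfl rfl rfl rfl rfl c₃ rfl rfl n₃ hδ0 hr0 a₃ b₃ d₃ p₃ q₃ hθ0 v₃
  obtain ⟨e₁, f₁, g₁, -, k₁⟩ :=
    param_cubic rfl rfl rfl rfl rfl rfl rfl c₁ rfl rfl n₁ hδ0 hr0 a₁ b₁ d₁
  obtain ⟨e₂, f₂, g₂, -, k₂⟩ :=
    param_cubic rfl rfl rfl rfl rfl rfl rfl c₂ rfl rfl n₂ hδ0 hr0 a₂ b₂ d₂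
  obtain ⟨e₃, f₃, g₃, -, k₃⟩ :=
    param_cubic rfl rfl rfl rfl rfl rfl rfl c₃ rfl rfl n₃ hδ0 hr0 a₃ b₃ d₃
  have hθ2 : 1 - θ ^ 2 ≠ 0 := by
    rw [show 1 - θ ^ 2 = (1 + θ) * (1 - θ) by ring]; exact mul_ne_zero hr0 hθ1
  have hz₁ : 1 + x ^ 2 ≠ 0 := by rw [g₁]; simp [*]
  have hz₃ : 1 + Y ^ 2 ≠ 0 := by rw [g₃]; simp [*]
  have hS : x⁻¹ + x⁻¹⁻¹ = x + x⁻¹ := by rw [inv_inv, add_comm]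
  rw [hS] at w₂ k₂
  set u₁ := (1 - θ ^ 2) ^ 2 * η₁ ^ 2 / (1 + θ ^ 2 * η₁ ^ 2) ^ 2 with hu₁
  set u₂ := (1 - θ ^ 2) ^ 2 * η₂ ^ 2 / (1 + θ ^ 2 * η₂ ^ 2) ^ 2 with hu₂
  set u₃ := (1 - θ ^ 2) ^ 2 * η₃ ^ 2 / (1 + θ ^ 2 * η₃ ^ 2) ^ 2 with hu₃
  set μ := θ * (1 - θ) ^ 2 / ((1 - θ + θ ^ 2) * (1 + θ) ^ 2) with hμ
  have hμ0 : μ ≠ 0 := by simp [*]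
  set B := (1 - θ ^ 2) ^ 2 / (1 - θ + θ ^ 2) ^ 2 with hB
  have hB0 : B ≠ 0 := by simp [*]
  have hBμ : B ^ 2 * t ^ 2 = μ := by
    have : t ^ 2 = θ * (1 - θ + θ ^ 2) ^ 3 / ((1 + θ) ^ 6 * (1 - θ) ^ 2) := by
      rw [eq_div_iff (by simp [*])]; linear_combination ht
    rw [this, hB, hμ, show 1 - θ ^ 2 = (1 + θ) * (1 - θ) by ring]
    generalize 1 - θ + θ ^ 2 = δ at *
    generalize 1 + θ = r at *
    generalize 1 - θ = r' at *
    field_simp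
  have hYs : (Y + Y⁻¹) * (t * (x + x⁻¹)) = 1 := by
    have : Y + Y⁻¹ = (1 + Y ^ 2) / Y := by field_simp; ring
    rw [this, div_mul_eq_mul_div, div_eq_iff hY0]; linear_combination -hY
  have tr := trace_identity (μ := μ) (k := (x + x⁻¹) ^ 2 / B) (u₁ := u₁) (u₂ := u₂) (u₃ := u₃)
    (by rw [div_mul_eq_mul_div, div_mul_eq_mul_div, div_eq_iff hB0]; linear_combination k₁)
    (by rw [div_mul_eq_mul_div, div_mul_eq_mul_div, div_eq_iff hB0]; linear_combination k₂)
    (param_cubic_reciprocal hB0 hYs hBμ k₃)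
    hμ0 (by simp [*])
    (by
      rw [hu₁, hu₂, Ne, div_eq_div_iff (pow_ne_zero _ d₁) (pow_ne_zero _ d₂)]
      intro h; apply h12
      apply mul_left_cancel₀ (pow_ne_zero 2 hθ2); linear_combination h)
    (by
      rw [hu₁, hu₃, hμ, div_mul_div_comm, div_mul_div_comm, Ne, div_eq_one_iff_eq (by simp [*])]
      intro h; apply h13; linear_combination h)
    (by
      rw [hu₂, hu₃, hμ, div_mul_div_comm, div_mul_div_comm, Ne, div_eq_one_iff_eq (by simp [*])]
      intro h; apply h23; linear_combination h)
    (by rw [e₁]; simp [*]) (by rw [e₂]; simp [*]) (by rw [e₃]; simp [*])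
    (by rw [f₁]; simp [*]) (by rw [f₂]; simp [*]) (by rw [f₃]; simp [*])
  have hκ : (1 + θ) ^ 6 * (1 - θ) ^ 2 / (3 * θ * (1 - θ + θ ^ 2) ^ 3) = 1 / (3 * t ^ 2) := by
    rw [div_eq_div_iff (by simp [h3, hθ0, hδ0]) (by simp [h3, ht0])]; linear_combination 3 * ht
  have hR₃ : (1 + Y ^ 2) * (R₃ / Y) = (Y + Y⁻¹) * R₃ := by field_simp; ring
  have hsum : 1 / (1 + x ^ 2) + 1 / (1 + x⁻¹ ^ 2) = 1 := by
    have : x ^ 2 + 1 ≠ 0 := by rwa [add_comm]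
    field_simp; ring
  have hlast : (x + x⁻¹) ^ 2 * (1 + Y ^ 2) / 3 = 1 / (3 * t ^ 2) * (1 - 1 / (1 + Y ^ 2)) := by
    have h : Y ^ 2 = (t * (x + x⁻¹) * (1 + Y ^ 2)) ^ 2 := by rw [← hY]
    generalize x + x⁻¹ = s at *
    rw [one_sub_div hz₃, show 1 + Y ^ 2 - 1 = Y ^ 2 by ring]
    generalize hv : 1 + Y ^ 2 = v at *
    rw [h]; field_simp
  rw [hR₃, mul_add, w₁, w₂, w₃, ← tr, hκ, hlast]
  linear_combination 1 / (3 * t ^ 2) * hsum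

open PowerSeries in
theorem PowerSeries.eq_of_forall_X_pow_dvd {R : Type*} [CommRing R] {f g : R⟦X⟧}
    (h : ∀ n, (X : R⟦X⟧) ^ n ∣ f - g) : f = g := by
  ext n
  have := X_pow_dvd_iff.1 (h (n + 1)) n n.lt_succ_self
  rwa [map_sub, sub_eq_zero] at this

open PowerSeries in
/-- A polynomial equation `f = c + X * P(f)` can be solved in formal power series. -/
theorem PowerSeries.exists_eq_add_X_mul_eval {R : Type*} [CommRing R] (c : R⟦X⟧)
    (P : Polynomial R⟦X⟧) : ∃ f : R⟦X⟧, f = c + X * P.eval f := by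
  set Φ : R⟦X⟧ → R⟦X⟧ := fun f => c + X * P.eval f with hΦ
  have hΦd : ∀ n f g, (X : R⟦X⟧) ^ n ∣ f - g → X ^ (n + 1) ∣ Φ f - Φ g := by
    intro n f g h
    have : Φ f - Φ g = X * (P.eval f - P.eval g) := by simp only [hΦ]; ring
    rw [this, pow_succ']
    exact mul_dvd_mul_left _ (h.trans (Polynomial.sub_dvd_eval_sub _ _ _))
  have hit : ∀ n k, (X : R⟦X⟧) ^ n ∣ Φ^[n + k] 0 - Φ^[n] 0 := by
    intro n
    induction n with
    | zero => simp
    | succ n ih =>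
      intro k
      rw [show n + 1 + k = (n + k) + 1 by ring, Function.iterate_succ_apply',
        Function.iterate_succ_apply']
      exact hΦd _ _ _ (ih k)
  set f : R⟦X⟧ := mk fun n => coeff n (Φ^[n + 1] 0) with hf
  have hfd : ∀ n, (X : R⟦X⟧) ^ n ∣ f - Φ^[n] 0 := by
    intro n
    rw [X_pow_dvd_iff]
    intro m hm
    obtain ⟨k, rfl⟩ := Nat.exists_eq_add_of_le (Nat.succ_le_of_lt hm)
    have := X_pow_dvd_iff.1 (hit (m + 1) k) m m.lt_succ_self
    rw [map_sub] at this ⊢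
    rw [hf, coeff_mk, ← neg_sub, this, neg_zero]
  refine ⟨f, eq_of_forall_X_pow_dvd fun n => ?_⟩
  have h₁ := hfd (n + 1)
  have h₂ := hΦd n _ _ (hfd n)
  rw [← Function.iterate_succ_apply' Φ n] at h₂
  have h := (dvd_sub h₁ h₂)
  rw [sub_sub_sub_cancel_right] at h
  exact (pow_dvd_pow _ n.le_succ).trans h

open PowerSeries PowerSeries.WithPiTopology in
/-- Substitution of `z` for the inner variable of a power series with polynomial coefficients. -/
theorem PowerSeries.exists_innerEval {R : Type*} [CommRing R] (z : R⟦X⟧) :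
    ∃ e : (Polynomial R)⟦X⟧ →+* R⟦X⟧, e X = X ∧ ∀ p, e (C p) = Polynomial.aeval z p := by
  let _ : UniformSpace R := ⊥
  have _ : DiscreteTopology R := ⟨rfl⟩
  let _ : UniformSpace (Polynomial R) := ⊥
  have _ : DiscreteTopology (Polynomial R) := ⟨rfl⟩
  have hX : HasEval (X : R⟦X⟧) := HasEval.X
  have hc : Continuous ((Polynomial.aeval z : Polynomial R →ₐ[R] R⟦X⟧) : Polynomial R →+* R⟦X⟧) :=
    continuous_of_discreteTopology
  refine ⟨eval₂Hom hc hX, ?_, fun p => ?_⟩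
  · simp [coe_eval₂Hom]
  · simp [coe_eval₂Hom]

open PowerSeries in
/-- The formal sum `∑ Xᵏ aₖ`. -/
noncomputable def PowerSeries.xSum {R : Type*} [CommRing R] (a : ℕ → R⟦X⟧) : R⟦X⟧ :=
  mk fun n => coeff n (∑ k ∈ Finset.range (n + 1), X ^ k * a k)

open PowerSeries in
theorem PowerSeries.X_pow_dvd_xSum_sub {R : Type*} [CommRing R] (a : ℕ → R⟦X⟧) (N : ℕ) :
    (X : R⟦X⟧) ^ N ∣ xSum a - ∑ k ∈ Finset.range N, X ^ k * a k := by
  rw [X_pow_dvd_iff]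
  intro m hm
  obtain ⟨k, rfl⟩ := Nat.exists_eq_add_of_le (Nat.succ_le_of_lt hm)
  rw [map_sub, xSum, coeff_mk, Finset.sum_range_add _ (m + 1) k, map_add, sub_add_cancel_left, neg_eq_zero,
    map_sum]
  refine Finset.sum_eq_zero fun i _ => ?_
  rw [coeff_X_pow_mul', if_neg (by omega)]

open PowerSeries in
theorem PowerSeries.eq_xSum {R : Type*} [CommRing R] {a : ℕ → R⟦X⟧} {f : R⟦X⟧}
    (h : ∀ N, (X : R⟦X⟧) ^ N ∣ f - ∑ k ∈ Finset.range N, X ^ k * a k) : f = xSum a :=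
  eq_of_forall_X_pow_dvd fun n => by
    simpa using dvd_sub (h n) (X_pow_dvd_xSum_sub a n)

open PowerSeries in
theorem PowerSeries.map_xSum {R S : Type*} [CommRing R] [CommRing S] (e : R⟦X⟧ →+* S⟦X⟧)
    (he : e X = X) (a : ℕ → R⟦X⟧) : e (xSum a) = xSum fun k => e (a k) := by
  refine eq_xSum fun N => ?_
  have := map_dvd e (X_pow_dvd_xSum_sub a N)
  simpa [he] using this

open PowerSeries in
theorem PowerSeries.xSum_succ {R : Type*} [CommRing R] (a : ℕ → R⟦X⟧) :
    xSum a = a 0 + X * xSum fun k => a (k + 1) := by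
  refine (eq_xSum fun N => ?_).symm
  rcases N with _ | N
  · simp
  · rw [Finset.sum_range_succ', pow_zero, one_mul, add_comm (a 0), add_sub_add_right_eq_sub]
    have : X * xSum (fun k => a (k + 1)) - ∑ k ∈ Finset.range N, X ^ (k + 1) * a (k + 1) =
        X * (xSum (fun k => a (k + 1)) - ∑ k ∈ Finset.range N, X ^ k * a (k + 1)) := by
      rw [mul_sub, Finset.mul_sum]
      congr 1
      exact Finset.sum_congr rfl fun k _ => by ring
    rw [this, pow_succ']
    exact mul_dvd_mul_left _ (X_pow_dvd_xSum_sub _ N)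

/-- Sum over the four diagonal neighbours lying in `S`. -/
noncomputable def diagStep {A : Type*} [CommRing A] (S : Set (ℤ × ℤ)) :
    (ℤ × ℤ → A) →ₗ[A] (ℤ × ℤ → A) where
  toFun w q := S.indicator w (q + (1, 1)) + S.indicator w (q + (1, -1)) +
    S.indicator w (q + (-1, 1)) + S.indicator w (q + (-1, -1))
  map_add' v w := by
    funext q; simp only [Set.indicator_add', Pi.add_apply]; ring
  map_smul' c w := by
    funext q; simp only [Pi.smul_apply, smul_eq_mul, RingHom.id_apply, Set.indicator]
    split_ifs <;> ring

theorem diagStep_apply {A : Type*} [CommRing A] (S : Set (ℤ × ℤ)) (w : ℤ × ℤ → A) (q : ℤ × ℤ) :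
    diagStep S w q = S.indicator w (q + (1, 1)) + S.indicator w (q + (1, -1)) +
      S.indicator w (q + (-1, 1)) + S.indicator w (q + (-1, -1)) := rfl

theorem diagStep_pow_congr {A : Type*} [CommRing A] {S : Set (ℤ × ℤ)} {v w : ℤ × ℤ → A}
    (h : ∀ p ∈ S, Even (p.1 + p.2) → v p = w p) (n : ℕ) :
    ∀ p ∈ S, Even (p.1 + p.2) → (diagStep S ^ n) v p = (diagStep S ^ n) w p := by
  classical
  induction n with
  | zero => simpa using h
  | succ n ih =>
    intro p _ hp
    have hi : ∀ q : ℤ × ℤ, Even (q.1 + q.2) →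
        S.indicator ((diagStep S ^ n) v) q = S.indicator ((diagStep S ^ n) w) q := by
      intro q hq
      by_cases hqS : q ∈ S
      · simp [hqS, ih q hqS hq]
      · simp [hqS]
    rw [pow_succ', Module.End.mul_apply, Module.End.mul_apply, diagStep_apply, diagStep_apply]
    obtain ⟨c, hc⟩ := hp
    rw [hi, hi, hi, hi]
    · exact ⟨c - 1, by simp; omega⟩
    · exact ⟨c, by simp; omega⟩
    · exact ⟨c, by simp; omega⟩
    · exact ⟨c + 1, by simp; omega⟩

theorem map_diagStep_pow {A B : Type*} [CommRing A] [CommRing B] (e : A →+* B) (S : Set (ℤ × ℤ))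
    (w : ℤ × ℤ → A) (n : ℕ) (p : ℤ × ℤ) :
    e ((diagStep S ^ n) w p) = (diagStep S ^ n) (fun q => e (w q)) p := by
  classical
  induction n generalizing p with
  | zero => simp
  | succ n ih =>
    have hi : ∀ q : ℤ × ℤ, e (S.indicator ((diagStep S ^ n) w) q) =
        S.indicator ((diagStep S ^ n) (fun q => e (w q))) q := by
      intro q
      by_cases hqS : q ∈ S <;> simp [hqS, ih q]
    rw [pow_succ', Module.End.mul_apply, pow_succ', Module.End.mul_apply, diagStep_apply,
      diagStep_apply, map_add, map_add, map_add, hi, hi, hi, hi]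

open PowerSeries in
/-- Generating function of diagonal walks from the origin confined to `S`, weighted by the value of
`w` at the endpoint. -/
noncomputable def walkGF {R : Type*} [CommRing R] (S : Set (ℤ × ℤ)) :
    (ℤ × ℤ → R⟦X⟧) →ₗ[R⟦X⟧] R⟦X⟧ where
  toFun w := xSum fun k => (diagStep S ^ k) w 0
  map_add' v w := by
    refine (eq_xSum fun N => ?_).symm
    have := dvd_add (X_pow_dvd_xSum_sub (fun k => (diagStep S ^ k) v 0) N)
      (X_pow_dvd_xSum_sub (fun k => (diagStep S ^ k) w 0) N)
    convert this using 1
    simp only [map_add, Pi.add_apply, mul_add, Finset.sum_add_distrib]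
    ring
  map_smul' c w := by
    refine (eq_xSum fun N => ?_).symm
    have := (X_pow_dvd_xSum_sub (fun k => (diagStep S ^ k) w 0) N).mul_left c
    convert this using 1
    simp only [map_smul, Pi.smul_apply, smul_eq_mul, RingHom.id_apply, mul_sub, Finset.mul_sum]
    congr 1
    exact Finset.sum_congr rfl fun k _ => by ring

open PowerSeries in
theorem walkGF_apply {R : Type*} [CommRing R] (S : Set (ℤ × ℤ)) (w : ℤ × ℤ → R⟦X⟧) :
    walkGF S w = xSum fun k => (diagStep S ^ k) w 0 := rfl

open PowerSeries in
theorem walkGF_congr {R : Type*} [CommRing R] {S : Set (ℤ × ℤ)} {v w : ℤ × ℤ → R⟦X⟧}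
    (hS : 0 ∈ S) (h : ∀ p ∈ S, Even (p.1 + p.2) → v p = w p) : walkGF S v = walkGF S w := by
  rw [walkGF_apply, walkGF_apply]
  congr 1
  funext k
  exact diagStep_pow_congr h k 0 hS (by simp)

open PowerSeries in
theorem walkGF_eq {R : Type*} [CommRing R] (S : Set (ℤ × ℤ)) (w : ℤ × ℤ → R⟦X⟧) :
    walkGF S w = w 0 + X * walkGF S (diagStep S w) := by
  rw [walkGF_apply, xSum_succ, walkGF_apply]
  simp [pow_succ]

open PowerSeries in
theorem map_walkGF {R R' : Type*} [CommRing R] [CommRing R'] (e : R⟦X⟧ →+* R'⟦X⟧)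
    (he : e X = X) (S : Set (ℤ × ℤ)) (w : ℤ × ℤ → R⟦X⟧) :
    e (walkGF S w) = walkGF S fun q => e (w q) := by
  rw [walkGF_apply, map_xSum e he, walkGF_apply]
  simp only [map_diagStep_pow]

/-- Sum of the two neighbours of a function on `ℤ`. -/
def shiftSum {A : Type*} [CommRing A] : (ℤ → A) →ₗ[A] (ℤ → A) where
  toFun f i := f (i + 1) + f (i - 1)
  map_add' f g := by funext i; simp only [Pi.add_apply]; ring
  map_smul' c f := by funext i; simp only [Pi.smul_apply, smul_eq_mul, RingHom.id_apply]; ring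

theorem shiftSum_apply {A : Type*} [CommRing A] (f : ℤ → A) (i : ℤ) :
    shiftSum f i = f (i + 1) + f (i - 1) := rfl

/-- The indicator function of a point of `ℤ`. -/
def pt {A : Type*} [CommRing A] (k : ℤ) (i : ℤ) : A := if i = k then 1 else 0

/-- The geometric sequence `zⁱ` on the nonnegative integers, extended by zero. -/
def geo {A : Type*} [CommRing A] (z : A) (i : ℤ) : A := if 0 ≤ i then z ^ i.toNat else 0

/-- The reflection `i ↦ -i - 2`. -/
def mirror {A : Type*} (f : ℤ → A) (i : ℤ) : A := f (-i - 2)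

/-- The geometric sequence read leftwards from `-1`. -/
def leftGeo {A : Type*} [CommRing A] (z : A) (i : ℤ) : A := geo z (-i - 1)

theorem shiftSum_pt {A : Type*} [CommRing A] (k : ℤ) :
    shiftSum (pt k : ℤ → A) = pt (k - 1) + pt (k + 1) := by
  funext i
  simp only [shiftSum_apply, pt, Pi.add_apply]
  congr 1 <;> · congr 1; rw [eq_iff_iff]; omega

theorem geo_of_neg {A : Type*} [CommRing A] (z : A) {i : ℤ} (h : i < 0) : geo z i = 0 := by
  rw [geo, if_neg (by omega)]

theorem geo_natCast {A : Type*} [CommRing A] (z : A) (n : ℕ) : geo z n = z ^ n := by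
  simp [geo]

theorem shiftSum_geo {A : Type*} [CommRing A] (z : A) :
    z • shiftSum (geo z) = (1 + z ^ 2) • geo z - pt 0 + z • pt (-1) := by
  funext i
  simp only [shiftSum_apply, pt, Pi.add_apply, Pi.sub_apply, Pi.smul_apply, smul_eq_mul]
  rcases lt_trichotomy i (-1) with h | rfl | h
  · rw [geo_of_neg _ (by omega), geo_of_neg _ (by omega), geo_of_neg _ (by omega),
      if_neg (by omega), if_neg (by omega)]
    simp
  · simp [geo]
  · obtain ⟨n, rfl⟩ := Int.eq_ofNat_of_zero_le (show 0 ≤ i by omega)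
    have h1 : ((n : ℤ) + 1) = ((n + 1 : ℕ) : ℤ) := by push_cast; rfl
    rw [h1, geo_natCast, geo_natCast, if_neg (show (n : ℤ) ≠ -1 by omega)]
    rcases n with _ | n
    · simp [geo]; ring
    · rw [show ((n + 1 : ℕ) : ℤ) - 1 = (n : ℤ) by push_cast; ring, geo_natCast,
        if_neg (by omega)]
      ring

theorem shiftSum_leftGeo {A : Type*} [CommRing A] (z : A) :
    z • shiftSum (leftGeo z) = (1 + z ^ 2) • leftGeo z - pt (-1) + z • pt 0 := by
  funext i
  have := congrFun (shiftSum_geo z) (-i - 1)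
  simp only [shiftSum_apply, pt, Pi.add_apply, Pi.sub_apply, Pi.smul_apply, smul_eq_mul,
    leftGeo] at this ⊢
  rw [show -(i + 1) - 1 = -i - 1 - 1 by ring, show -(i - 1) - 1 = -i - 1 + 1 by ring, add_comm,
    this]
  congr 1
  · congr 2; rw [eq_iff_iff]; omega
  · congr 2; rw [eq_iff_iff]; omega

theorem leftGeo_eq {A : Type*} [CommRing A] (z : A) :
    leftGeo z = pt (-1) + z • mirror (geo z) := by
  funext i
  simp only [pt, Pi.add_apply, Pi.smul_apply, smul_eq_mul, leftGeo, mirror]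
  rcases lt_trichotomy i (-1) with h | rfl | h
  · obtain ⟨n, hn⟩ := Int.eq_ofNat_of_zero_le (show 0 ≤ -i - 2 by omega)
    rw [hn, show -i - 1 = ((n + 1 : ℕ) : ℤ) by push_cast; omega, geo_natCast, geo_natCast,
      if_neg (by omega)]
    ring
  · simp [geo]
  · rw [geo_of_neg _ (by omega), geo_of_neg _ (by omega), if_neg (by omega)]; simp

theorem mirror_pt {A : Type*} [CommRing A] (k : ℤ) : mirror (pt k : ℤ → A) = pt (-k - 2) := by
  funext i
  simp only [mirror, pt]
  congr 1; rw [eq_iff_iff]; omega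

theorem map_geo {A B : Type*} [CommRing A] [CommRing B] (e : A →+* B) (z : A) (i : ℤ) :
    e (geo z i) = geo (e z) i := by
  rw [geo, geo]; split_ifs <;> simp

theorem map_pt {A B : Type*} [CommRing A] [CommRing B] (e : A →+* B) (k i : ℤ) :
    e (pt k i) = pt k i := by
  rw [pt, pt]; split_ifs <;> simp

theorem geo_zero {A : Type*} [CommRing A] : geo (0 : A) = pt 0 := by
  funext i
  rw [geo, pt]
  split_ifs with h h' h'
  · simp [h']
  · exact zero_pow (by omega)
  · omega
  · rfl

open PowerSeries in
/-- `walkGF` on weights that are products of functions of the two coordinates. -/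
noncomputable def boxGF {R : Type*} [CommRing R] (S : Set (ℤ × ℤ)) :
    (ℤ → R⟦X⟧) →ₗ[R⟦X⟧] (ℤ → R⟦X⟧) →ₗ[R⟦X⟧] R⟦X⟧ :=
  LinearMap.mk₂ _ (fun f g => walkGF S fun p => f p.1 * g p.2)
    (fun f f' g => by rw [← map_add]; congr 1; funext p; simp [add_mul])
    (fun c f g => by rw [← map_smul]; congr 1; funext p; simp [mul_assoc])
    (fun f g g' => by rw [← map_add]; congr 1; funext p; simp [mul_add])
    (fun c f g => by rw [← map_smul]; congr 1; funext p; simp [mul_left_comm])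

open PowerSeries in
theorem boxGF_apply {R : Type*} [CommRing R] (S : Set (ℤ × ℤ)) (f g : ℤ → R⟦X⟧) :
    boxGF S f g = walkGF S fun p => f p.1 * g p.2 := rfl

open PowerSeries in
theorem boxGF_eq_zero {R : Type*} [CommRing R] {S : Set (ℤ × ℤ)} (hS : 0 ∈ S) {f g : ℤ → R⟦X⟧}
    (h : ∀ i j, (i, j) ∈ S → Even (i + j) → f i * g j = 0) : boxGF S f g = 0 := by
  rw [boxGF_apply, walkGF_congr (w := 0) hS (fun p hp hp' => h p.1 p.2 hp hp'), map_zero]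

open PowerSeries in
theorem boxGF_eq {R : Type*} [CommRing R] {S : Set (ℤ × ℤ)} {f g : ℤ → R⟦X⟧}
    (h : ∀ i j, (i, j) ∉ S → f i * g j = 0) :
    boxGF S f g = f 0 * g 0 + X * boxGF S (shiftSum f) (shiftSum g) := by
  rw [boxGF_apply, walkGF_eq, boxGF_apply]
  congr 3
  have hi : S.indicator (fun p : ℤ × ℤ => f p.1 * g p.2) = fun p => f p.1 * g p.2 :=
    Set.indicator_eq_self.2 fun p hp => by_contra fun hp' => hp (h _ _ hp')
  funext p
  rw [diagStep_apply, hi]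
  simp only [shiftSum_apply, Prod.fst_add, Prod.snd_add, ← sub_eq_add_neg]
  ring

open PowerSeries in
theorem map_boxGF {R R' : Type*} [CommRing R] [CommRing R'] (e : R⟦X⟧ →+* R'⟦X⟧)
    (he : e X = X) (S : Set (ℤ × ℤ)) (f g : ℤ → R⟦X⟧) :
    e (boxGF S f g) = boxGF S (fun i => e (f i)) (fun j => e (g j)) := by
  rw [boxGF_apply, map_walkGF e he, boxGF_apply]
  simp only [map_mul]

theorem diagStep_pow_swap {A : Type*} [CommRing A] {S : Set (ℤ × ℤ)}
    (hS : ∀ p, p.swap ∈ S ↔ p ∈ S) (w : ℤ × ℤ → A) (n : ℕ) (p : ℤ × ℤ) :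
    (diagStep S ^ n) w p.swap = (diagStep S ^ n) (fun q => w q.swap) p := by
  induction n generalizing p with
  | zero => simp
  | succ n ih =>
    have hi : ∀ q : ℤ × ℤ, S.indicator ((diagStep S ^ n) w) q.swap =
        S.indicator ((diagStep S ^ n) (fun q => w q.swap)) q := by
      intro q
      by_cases hqS : q ∈ S <;> simp [hqS, hS, ih q]
    rw [pow_succ', Module.End.mul_apply, Module.End.mul_apply, diagStep_apply,
      diagStep_apply, ← hi, ← hi, ← hi, ← hi]
    simp only [Prod.swap_add, Prod.swap_prod_mk]
    ring

open PowerSeries in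
theorem boxGF_swap {R : Type*} [CommRing R] {S : Set (ℤ × ℤ)} (hS : ∀ p, p.swap ∈ S ↔ p ∈ S)
    (f g : ℤ → R⟦X⟧) : boxGF S f g = boxGF S g f := by
  rw [boxGF_apply, boxGF_apply, walkGF_apply, walkGF_apply]
  congr 1
  funext k
  rw [show (0 : ℤ × ℤ) = Prod.swap 0 from rfl, diagStep_pow_swap hS]
  simp [mul_comm]

theorem zero_mem_coneC : (0 : ℤ × ℤ) ∈ coneC := by simp [coneC]

theorem zero_mem_quadQ : (0 : ℤ × ℤ) ∈ quadQ := by simp [quadQ]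

theorem swap_mem_coneC (p : ℤ × ℤ) : p.swap ∈ coneC ↔ p ∈ coneC := by simp [coneC, or_comm]

theorem swap_mem_quadQ (p : ℤ × ℤ) : p.swap ∈ quadQ ↔ p ∈ quadQ := by simp [quadQ, and_comm]

theorem mk_mem_coneC {i j : ℤ} : (i, j) ∈ coneC ↔ 0 ≤ i ∨ 0 ≤ j := Iff.rfl

theorem mk_mem_quadQ {i j : ℤ} : (i, j) ∈ quadQ ↔ 0 ≤ i ∧ 0 ≤ j := Iff.rfl

/-- Restriction of a function on `ℤ` to the nonnegative integers. -/
def nonnegPart {A : Type*} [CommRing A] (f : ℤ → A) (i : ℤ) : A := if 0 ≤ i then f i else 0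

theorem shiftSum_eq_nonnegPart_add {A : Type*} [CommRing A] {g : ℤ → A} (hg : ∀ i < 0, g i = 0) :
    shiftSum g = nonnegPart (shiftSum g) + g 0 • pt (-1) := by
  funext i
  simp only [nonnegPart, pt, shiftSum_apply, Pi.add_apply, Pi.smul_apply, smul_eq_mul]
  rcases lt_trichotomy i (-1) with h | rfl | h
  · rw [hg _ (by omega), hg _ (by omega), if_neg (by omega), if_neg (by omega)]; simp
  · simp [hg]
  · rw [if_pos (by omega), if_neg (by omega)]; simp

theorem shiftSum_mirror {A : Type*} [CommRing A] {g : ℤ → A} (hg : ∀ i < 0, g i = 0) :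
    shiftSum (mirror g) = mirror (nonnegPart (shiftSum g)) + g 0 • pt (-1) := by
  funext i
  simp only [nonnegPart, mirror, pt, shiftSum_apply, Pi.add_apply, Pi.smul_apply, smul_eq_mul]
  rw [show -(i + 1) - 2 = -i - 2 - 1 by ring, show -(i - 1) - 2 = -i - 2 + 1 by ring]
  rcases lt_trichotomy i (-1) with h | rfl | h
  · rw [if_pos (by omega), if_neg (by omega)]; ring
  · simp [hg]
  · rw [hg _ (by omega), hg _ (by omega), if_neg (by omega), if_neg (by omega)]; simp

open PowerSeries in
/-- The reflection principle relating the three-quadrant cone to the quadrant. -/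
theorem boxGF_coneC_sub_mirror {R : Type*} [CommRing R] {g h : ℤ → R⟦X⟧}
    (hg : ∀ i < 0, g i = 0) (hh : ∀ i < 0, h i = 0) :
    boxGF coneC g h - boxGF coneC (mirror g) h - boxGF coneC g (mirror h) = boxGF quadQ g h := by
  have hdvd : ∀ n : ℕ, ∀ g h : ℤ → R⟦X⟧, (∀ i < 0, g i = 0) → (∀ i < 0, h i = 0) →
      (X : R⟦X⟧) ^ n ∣ boxGF coneC g h - boxGF coneC (mirror g) h - boxGF coneC g (mirror h) -
        boxGF quadQ g h := by
    intro n
    induction n with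
    | zero => simp
    | succ n ih =>
      intro g h hg hh
      have e₁ := boxGF_eq (S := coneC) (f := g) (g := h) fun i j hij => by
        rw [mk_mem_coneC] at hij; rw [hg i (by omega), zero_mul]
      have e₂ := boxGF_eq (S := coneC) (f := mirror g) (g := h) fun i j hij => by
        rw [mk_mem_coneC] at hij; rw [hh j (by omega), mul_zero]
      have e₃ := boxGF_eq (S := coneC) (f := g) (g := mirror h) fun i j hij => by
        rw [mk_mem_coneC] at hij; rw [hg i (by omega), zero_mul]
      have e₄ := boxGF_eq (S := quadQ) (f := g) (g := h) fun i j hij => by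
        rw [mk_mem_quadQ] at hij
        by_cases hi : 0 ≤ i
        · rw [hh j (by omega), mul_zero]
        · rw [hg i (by omega), zero_mul]
      rw [shiftSum_eq_nonnegPart_add hg, shiftSum_eq_nonnegPart_add hh] at e₁ e₄
      rw [shiftSum_mirror hg, shiftSum_eq_nonnegPart_add hh] at e₂
      rw [shiftSum_mirror hh, shiftSum_eq_nonnegPart_add hg] at e₃
      set G := nonnegPart (shiftSum g)
      set H := nonnegPart (shiftSum h)
      have hG : ∀ i < 0, G i = 0 := fun i hi => if_neg (by omega)
      have hH : ∀ i < 0, H i = 0 := fun i hi => if_neg (by omega)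
      have hmg : mirror g 0 = 0 := hg _ (by norm_num)
      have hmh : mirror h 0 = 0 := hh _ (by norm_num)
      have z₁ : boxGF coneC (mirror G) (pt (-1)) = 0 := by
        refine boxGF_eq_zero zero_mem_coneC fun i j hij _ => ?_
        rw [mk_mem_coneC] at hij
        by_cases hj : j = -1
        · rw [mirror, hG _ (by omega), zero_mul]
        · rw [pt, if_neg hj, mul_zero]
      have z₂ : boxGF coneC (pt (-1)) (mirror H) = 0 := by
        refine boxGF_eq_zero zero_mem_coneC fun i j hij _ => ?_
        rw [mk_mem_coneC] at hij
        by_cases hi : i = -1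
        · rw [mirror, hH _ (by omega), mul_zero]
        · rw [pt, if_neg hi, zero_mul]
      have z₃ : boxGF coneC (pt (-1) : ℤ → R⟦X⟧) (pt (-1)) = 0 := by
        refine boxGF_eq_zero zero_mem_coneC fun i j hij _ => ?_
        rw [mk_mem_coneC] at hij
        by_cases hi : i = -1
        · rw [pt, pt, if_neg (show ¬ j = -1 by omega), mul_zero]
        · rw [pt, if_neg hi, zero_mul]
      have z₄ : ∀ f : ℤ → R⟦X⟧, boxGF quadQ f (pt (-1)) = 0 := fun f => by
        refine boxGF_eq_zero zero_mem_quadQ fun i j hij _ => ?_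
        rw [mk_mem_quadQ] at hij
        rw [pt, if_neg (by omega), mul_zero]
      have z₅ : ∀ f : ℤ → R⟦X⟧, boxGF quadQ (pt (-1)) f = 0 := fun f => by
        refine boxGF_eq_zero zero_mem_quadQ fun i j hij _ => ?_
        rw [mk_mem_quadQ] at hij
        rw [pt, if_neg (by omega), zero_mul]
      simp only [map_add, map_smul, LinearMap.add_apply, LinearMap.smul_apply, smul_eq_mul, z₁, z₂,
        z₃, z₄, z₅, hmg, hmh] at e₁ e₂ e₃ e₄
      have e : boxGF coneC g h - boxGF coneC (mirror g) h - boxGF coneC g (mirror h) -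
          boxGF quadQ g h = X * (boxGF coneC G H - boxGF coneC (mirror G) H -
            boxGF coneC G (mirror H) - boxGF quadQ G H) := by
        rw [e₁, e₂, e₃, e₄]; ring
      rw [e, pow_succ']
      exact mul_dvd_mul_left _ (ih G H hG hH)
  exact eq_of_forall_X_pow_dvd fun n => hdvd n g h hg hh

section FunctionalEquation

open PowerSeries

variable {R : Type*} [CommRing R] {x x' s Y : R⟦X⟧}

theorem boxGF_coneC_pt_odd {k l : ℤ} (h : ¬ Even (k + l)) :
    boxGF coneC (pt k : ℤ → R⟦X⟧) (pt l) = 0 := by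
  refine boxGF_eq_zero zero_mem_coneC fun i j _ hij => ?_
  by_cases hi : i = k
  · rw [pt, pt, if_neg (show ¬ j = l by rintro rfl; exact h (hi ▸ hij)), mul_zero]
  · rw [pt, if_neg hi, zero_mul]

theorem boxGF_coneC_of_neg {f g : ℤ → R⟦X⟧} (hf : ∀ i, 0 ≤ i → f i = 0)
    (hg : ∀ j, 0 ≤ j → g j = 0) : boxGF coneC f g = 0 := by
  refine boxGF_eq_zero zero_mem_coneC fun i j hij _ => ?_
  rcases mk_mem_coneC.1 hij with h | h
  · rw [hf i h, zero_mul]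
  · rw [hg j h, mul_zero]

theorem pt_neg_one_of_nonneg (i : ℤ) (hi : 0 ≤ i) : (pt (-1) i : R⟦X⟧) = 0 := by
  rw [pt, if_neg (by omega)]

theorem pt_neg_two_of_nonneg (i : ℤ) (hi : 0 ≤ i) : (pt (-2) i : R⟦X⟧) = 0 := by
  rw [pt, if_neg (by omega)]

theorem leftGeo_of_nonneg (z : R⟦X⟧) (i : ℤ) (hi : 0 ≤ i) : leftGeo z i = 0 :=
  geo_of_neg _ (by omega)

theorem boxGF_leftGeo (z : R⟦X⟧) :
    boxGF coneC (leftGeo z) (pt 0) = z * boxGF coneC (mirror (geo z)) (pt 0) := by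
  rw [leftGeo_eq, map_add, LinearMap.add_apply, map_smul, LinearMap.smul_apply, smul_eq_mul,
    boxGF_coneC_pt_odd (by decide), zero_add]

variable [IsDomain R]

theorem coneC_corner_equation (hs : x * s = 1 + x ^ 2) (hY : Y = X * s * (1 + Y ^ 2)) :
    (1 + x ^ 2) * boxGF coneC (leftGeo x) (pt 0) + (1 + Y ^ 2) * boxGF coneC (pt (-1)) (geo Y) =
      x * (1 + Y ^ 2) * boxGF coneC (pt 0) (geo Y) - x * boxGF coneC (pt 0) (pt 0) := by
  have e := boxGF_eq (S := coneC) (f := leftGeo x) (g := geo Y) fun i j hij => by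
    rw [mk_mem_coneC] at hij; rw [geo_of_neg _ (by omega), mul_zero]
  rw [leftGeo_of_nonneg _ _ le_rfl, zero_mul, zero_add] at e
  have e' : x * Y * boxGF coneC (leftGeo x) (geo Y) =
      X * boxGF coneC (x • shiftSum (leftGeo x)) (Y • shiftSum (geo Y)) := by
    rw [e]; simp only [map_smul, LinearMap.smul_apply, smul_eq_mul]; ring
  rw [shiftSum_leftGeo, shiftSum_geo] at e'
  have z₁ := boxGF_coneC_of_neg (leftGeo_of_nonneg x) (pt_neg_one_of_nonneg (R := R))
  have z₂ := boxGF_coneC_of_neg (pt_neg_one_of_nonneg (R := R)) (pt_neg_one_of_nonneg (R := R))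
  have z₃ := boxGF_coneC_pt_odd (R := R) (k := -1) (l := 0) (by decide)
  have z₄ := boxGF_coneC_pt_odd (R := R) (k := 0) (l := -1) (by decide)
  simp only [map_add, map_sub, map_smul, LinearMap.add_apply, LinearMap.sub_apply,
    LinearMap.smul_apply, smul_eq_mul, z₁, z₂, z₃, z₄] at e'
  apply mul_left_cancel₀ (X_ne_zero (R := R))
  linear_combination e' - boxGF coneC (leftGeo x) (geo Y) * x * hY
    - boxGF coneC (leftGeo x) (geo Y) * X * (1 + Y ^ 2) * hs

theorem coneC_column_equation (hY : Y = X * s * (1 + Y ^ 2)) :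
    s * (1 + Y ^ 2) * boxGF coneC (pt (-1)) (geo Y) =
      (1 + Y ^ 2) * (boxGF coneC (pt 0) (geo Y) + boxGF coneC (pt (-2)) (geo Y)) -
        boxGF coneC (pt 0) (pt 0) - boxGF coneC (pt (-2)) (pt 0) := by
  have e := boxGF_eq (S := coneC) (f := pt (-1)) (g := geo Y) fun i j hij => by
    rw [mk_mem_coneC] at hij; rw [geo_of_neg _ (by omega), mul_zero]
  rw [pt_neg_one_of_nonneg _ le_rfl, zero_mul, zero_add] at e
  have e' : Y * boxGF coneC (pt (-1)) (geo Y) =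
      X * boxGF coneC (shiftSum (pt (-1))) (Y • shiftSum (geo Y)) := by
    rw [e]; simp only [map_smul, smul_eq_mul]; ring
  rw [shiftSum_pt, shiftSum_geo, show (-1 - 1 : ℤ) = -2 by norm_num,
    show (-1 + 1 : ℤ) = 0 by norm_num] at e'
  have z₁ := boxGF_coneC_of_neg (pt_neg_two_of_nonneg (R := R)) (pt_neg_one_of_nonneg (R := R))
  have z₄ := boxGF_coneC_pt_odd (R := R) (k := 0) (l := -1) (by decide)
  simp only [map_add, map_sub, map_smul, LinearMap.add_apply, smul_eq_mul, z₁, z₄] at e'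
  apply mul_left_cancel₀ (X_ne_zero (R := R))
  linear_combination e' - boxGF coneC (pt (-1)) (geo Y) * hY

theorem quadQ_equation (hs : x * s = 1 + x ^ 2) (hY : Y = X * s * (1 + Y ^ 2)) :
    (1 + x ^ 2) * boxGF quadQ (geo x) (pt 0) + (1 + Y ^ 2) * boxGF quadQ (geo Y) (pt 0) =
      (1 + x ^ 2) * (1 + Y ^ 2) + boxGF quadQ (pt 0) (pt 0) := by
  have e := boxGF_eq (S := quadQ) (f := geo x) (g := geo Y) fun i j hij => by
    rw [mk_mem_quadQ] at hij
    by_cases hi : 0 ≤ i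
    · rw [geo_of_neg Y (by omega), mul_zero]
    · rw [geo_of_neg x (by omega), zero_mul]
  have e' : x * Y * boxGF quadQ (geo x) (geo Y) =
      x * Y + X * boxGF quadQ (x • shiftSum (geo x)) (Y • shiftSum (geo Y)) := by
    rw [e]; simp only [map_smul, LinearMap.smul_apply, smul_eq_mul, geo]; simp; ring
  rw [shiftSum_geo, shiftSum_geo] at e'
  have z₄ : ∀ f : ℤ → R⟦X⟧, boxGF quadQ f (pt (-1)) = 0 := fun f => by
    refine boxGF_eq_zero zero_mem_quadQ fun i j hij _ => ?_
    rw [mk_mem_quadQ] at hij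
    rw [pt, if_neg (by omega), mul_zero]
  have z₅ : ∀ f : ℤ → R⟦X⟧, boxGF quadQ (pt (-1)) f = 0 := fun f => by
    refine boxGF_eq_zero zero_mem_quadQ fun i j hij _ => ?_
    rw [mk_mem_quadQ] at hij
    rw [pt, if_neg (by omega), zero_mul]
  have hsw := boxGF_swap swap_mem_quadQ (pt 0) (geo Y)
  simp only [map_add, map_sub, map_smul, LinearMap.add_apply, LinearMap.sub_apply,
    LinearMap.smul_apply, smul_eq_mul, z₄, z₅, hsw] at e'
  apply mul_left_cancel₀ (X_ne_zero (R := R))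
  linear_combination e' - (boxGF quadQ (geo x) (geo Y) - 1) * x * hY
    - (boxGF quadQ (geo x) (geo Y) - 1) * X * (1 + Y ^ 2) * hs

/-- The kernel equation for walks in the three-quadrant cone. -/
theorem coneC_kernel_equation (hs : s = x + x') (hx : x * x' = 1)
    (hY : Y = X * s * (1 + Y ^ 2)) :
    s * (x * boxGF coneC (mirror (geo x)) (pt 0) + x' * boxGF coneC (mirror (geo x')) (pt 0)) =
      (1 + Y ^ 2) * (boxGF coneC (mirror (geo Y)) (pt 0) + boxGF quadQ (geo Y) (pt 0))
        - boxGF coneC (pt (-2)) (pt 0) - boxGF quadQ (pt 0) (pt 0) := by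
  have e₁ := coneC_corner_equation (x := x) (by rw [hs]; linear_combination hx) hY
  have e₂ := coneC_corner_equation (x := x') (by rw [hs]; linear_combination hx) hY
  have e₃ := coneC_column_equation hY
  have hp : ∀ i < 0, (pt 0 i : R⟦X⟧) = 0 := fun i hi => if_neg (by omega)
  have e₄ := boxGF_coneC_sub_mirror (h := geo Y) hp (fun i hi => geo_of_neg Y hi)
  have e₅ := boxGF_coneC_sub_mirror (R := R) hp hp
  rw [mirror_pt, show (-0 - 2 : ℤ) = -2 by norm_num] at e₄ e₅
  rw [boxGF_swap swap_mem_coneC (pt 0) (mirror (geo Y)), boxGF_swap swap_mem_quadQ] at e₄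
  rw [boxGF_swap swap_mem_coneC (pt 0) (pt (-2))] at e₅
  rw [boxGF_leftGeo] at e₁ e₂
  set U := boxGF coneC (mirror (geo x)) (pt 0)
  set U' := boxGF coneC (mirror (geo x')) (pt 0)
  set D := boxGF coneC (pt 0) (geo Y)
  set D₀ : R⟦X⟧ := boxGF coneC (pt 0) (pt 0)
  set N := boxGF coneC (pt (-1)) (geo Y)
  rw [hs] at e₃ ⊢
  linear_combination x' * e₁ + x * e₂ - e₃ + (1 + Y ^ 2) * e₄ - e₅
    + (2 * (1 + Y ^ 2) * D - 2 * D₀ - U * x ^ 2 - U' * x' ^ 2) * hx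

end FunctionalEquation

section InnerEval

open PowerSeries

variable {R : Type*} [CommRing R]

/-- Substitution of `z` for the inner variable of a power series with polynomial coefficients. -/
noncomputable def innerEval (z : R⟦X⟧) : (Polynomial R)⟦X⟧ →+* R⟦X⟧ :=
  (exists_innerEval z).choose

theorem innerEval_X (z : R⟦X⟧) : innerEval z X = X := (exists_innerEval z).choose_spec.1

theorem innerEval_C (z : R⟦X⟧) (p : Polynomial R) : innerEval z (C p) = Polynomial.aeval z p :=
  (exists_innerEval z).choose_spec.2 p

theorem innerEval_map_C (z f : R⟦X⟧) :
    innerEval z (PowerSeries.map Polynomial.C f) = f := by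
  have hpoly : ∀ p : Polynomial R, innerEval z (PowerSeries.map Polynomial.C (p : R⟦X⟧)) = p := by
    intro p
    induction p using Polynomial.induction_on' with
    | add p q hp hq => rw [Polynomial.coe_add, map_add, map_add, hp, hq]
    | monomial n a =>
      rw [← Polynomial.C_mul_X_pow_eq_monomial]
      simp only [Polynomial.coe_mul, Polynomial.coe_C, Polynomial.coe_pow, Polynomial.coe_X,
        map_mul, map_pow, map_X, innerEval_X, map_C, innerEval_C, Polynomial.aeval_C]
      rfl
  refine eq_of_forall_X_pow_dvd fun n => ?_
  have h := eq_X_pow_mul_shift_add_trunc n f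
  have h' := congrArg (fun g => innerEval z (PowerSeries.map Polynomial.C g)) h
  simp only [map_add, map_mul, map_pow, map_X, innerEval_X, hpoly] at h'
  refine ⟨innerEval z (PowerSeries.map Polynomial.C (mk fun i => coeff (i + n) f)) -
    mk fun i => coeff (i + n) f, ?_⟩
  linear_combination h' - h

theorem constantCoeff_innerEval (z : R⟦X⟧) (f : (Polynomial R)⟦X⟧) :
    constantCoeff (innerEval z f) = (constantCoeff f).eval (constantCoeff z) := by
  obtain ⟨g, hg⟩ : X ∣ f - C (constantCoeff f) := by rw [X_dvd_iff]; simp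
  rw [sub_eq_iff_eq_add.1 hg, map_add, map_mul, innerEval_X, innerEval_C, map_add,
    Polynomial.aeval_def, Polynomial.hom_eval₂, map_mul]
  simp [Polynomial.eval₂_eq_eval_map, algebraMap_eq]

end InnerEval

section Boundary

open PowerSeries

/-- The boundary generating function, as a power series in the length with coefficients polynomial
in the boundary variable. -/
noncomputable def boundaryGF : (Polynomial ℚ)⟦X⟧ :=
  boxGF coneC (mirror (geo (C Polynomial.X))) (pt 0) +
    C (Polynomial.C (1 / 3)) * boxGF quadQ (geo (C Polynomial.X)) (pt 0)

theorem innerEval_boundaryGF (z : ℚ⟦X⟧) :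
    innerEval z boundaryGF =
      boxGF coneC (mirror (geo z)) (pt 0) + C (1 / 3) * boxGF quadQ (geo z) (pt 0) := by
  have h₁ : (fun i => innerEval z (mirror (geo (C Polynomial.X)) i)) = mirror (geo z) := by
    funext i; rw [mirror, map_geo, innerEval_C, Polynomial.aeval_X, mirror]
  have h₂ : (fun i => innerEval z (geo (C Polynomial.X) i)) = geo z := by
    funext i; rw [map_geo, innerEval_C, Polynomial.aeval_X]
  have h₃ : (fun i => innerEval z (pt 0 i)) = pt 0 := by
    funext i; rw [map_pt]
  rw [boundaryGF, map_add, map_mul, map_boxGF _ (innerEval_X z), map_boxGF _ (innerEval_X z),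
    h₁, h₂, h₃, innerEval_C, Polynomial.aeval_C]
  rfl

theorem boundaryGF_kernel_equation {x : ℚ} (hx : x ≠ 0) {Y : ℚ⟦X⟧}
    (hY : Y = X * C (x + x⁻¹) * (1 + Y ^ 2)) :
    C (x + x⁻¹) * (C x * innerEval (C x) boundaryGF + C x⁻¹ * innerEval (C x⁻¹) boundaryGF) =
      (1 + Y ^ 2) * innerEval Y boundaryGF - innerEval 0 boundaryGF +
        C (1 / 3) * C (x + x⁻¹) ^ 2 * (1 + Y ^ 2) := by
  have hxx : (C x * C x⁻¹ : ℚ⟦X⟧) = 1 := by rw [← map_mul, mul_inv_cancel₀ hx, map_one]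
  have hs : (C (x + x⁻¹) : ℚ⟦X⟧) = C x + C x⁻¹ := map_add _ _ _
  have e₁ := coneC_kernel_equation hs hxx hY
  have e₂ := quadQ_equation (x := C x) (by rw [hs]; linear_combination hxx) hY
  have e₃ := quadQ_equation (x := C x⁻¹) (by rw [hs]; linear_combination hxx) hY
  have h3 : (3 * C (1 / 3) : ℚ⟦X⟧) = 1 := by
    rw [show (3 : ℚ⟦X⟧) = C 3 from rfl, ← map_mul]; norm_num
  simp only [innerEval_boundaryGF, geo_zero, mirror_pt, show (-0 - 2 : ℤ) = -2 by norm_num]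
  rw [hs] at e₁ ⊢
  generalize boxGF quadQ (geo (C x)) (pt 0) = W at *
  generalize boxGF quadQ (geo (C x⁻¹)) (pt 0) = W' at *
  generalize boxGF quadQ (geo Y) (pt 0) = V at *
  generalize boxGF quadQ (pt 0 : ℤ → ℚ⟦X⟧) (pt 0) = V₀ at *
  generalize boxGF coneC (mirror (geo (C x))) (pt 0) = U at *
  generalize boxGF coneC (mirror (geo (C x⁻¹))) (pt 0) = U' at *
  generalize boxGF coneC (pt (-2) : ℤ → ℚ⟦X⟧) (pt 0) = b at *
  generalize boxGF coneC (mirror (geo Y)) (pt 0) = B at *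
  generalize (C (1 / 3) : ℚ⟦X⟧) = k at *
  generalize (C x : ℚ⟦X⟧) = a at *
  generalize (C x⁻¹ : ℚ⟦X⟧) = a' at *
  linear_combination e₁ + k * e₂ + k * e₃ - ((1 + Y ^ 2) * V - V₀) * h3
    + k * (W + W' - 2 * (1 + Y ^ 2)) * hxx

theorem polynomial_eq_zero_of_symm {p : Polynomial ℚ}
    (h : ∀ x : ℚ, 1 < x → x * p.eval x + x⁻¹ * p.eval x⁻¹ = 0) : p = 0 := by
  have key : (Polynomial.X : Polynomial ℚ) ^ (p.natDegree + 2) * p + p.reverse = 0 := by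
    refine Polynomial.eq_zero_of_infinite_isRoot _ ((Set.Ioi_infinite (1 : ℚ)).mono ?_)
    intro x hx
    have hx0 : x ≠ 0 := by have : (1 : ℚ) < x := hx; positivity
    have : Invertible x⁻¹ := invertibleOfNonzero (inv_ne_zero hx0)
    have hr := Polynomial.eval₂_reverse_mul_pow (RingHom.id ℚ) x⁻¹ p
    rw [invOf_eq_inv, inv_inv, Polynomial.eval₂_id, Polynomial.eval₂_id] at hr
    have h' := h x hx
    rw [← hr] at h'
    simp only [Set.mem_ofPred_eq, Polynomial.IsRoot, Polynomial.eval_add,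
      Polynomial.eval_mul, Polynomial.eval_pow, Polynomial.eval_X]
    have : x ^ (p.natDegree + 1) * (x * p.eval x + x⁻¹ * (p.reverse.eval x * x⁻¹ ^ p.natDegree)) =
        x ^ (p.natDegree + 2) * p.eval x + p.reverse.eval x := by
      rw [inv_pow]; field_simp; ring
    rw [← this, h', mul_zero]
  by_contra hp
  have hdeg : (Polynomial.X ^ (p.natDegree + 2) * p).natDegree =
      p.natDegree + 2 + p.natDegree := by
    rw [Polynomial.natDegree_mul (pow_ne_zero _ Polynomial.X_ne_zero) hp,
      Polynomial.natDegree_X_pow]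
  have h2 := Polynomial.reverse_natDegree_le p
  rw [eq_neg_of_add_eq_zero_left key, Polynomial.natDegree_neg] at hdeg
  omega

/-- The homogeneous kernel equation has only the trivial solution. -/
theorem eq_zero_of_kernel_equation {F : (Polynomial ℚ)⟦X⟧}
    (h : ∀ x : ℚ, 1 < x → ∀ Y : ℚ⟦X⟧, Y = X * C (x + x⁻¹) * (1 + Y ^ 2) →
      C (x + x⁻¹) * (C x * innerEval (C x) F + C x⁻¹ * innerEval (C x⁻¹) F) =
        (1 + Y ^ 2) * innerEval Y F - innerEval 0 F) : F = 0 := by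
  refine eq_of_forall_X_pow_dvd fun n => ?_
  rw [sub_zero]
  induction n with
  | zero => simp
  | succ n ih =>
    obtain ⟨G, rfl⟩ := ih
    have hG : constantCoeff G = 0 := by
      refine polynomial_eq_zero_of_symm fun x hx => ?_
      obtain ⟨Y, hY⟩ := exists_eq_add_X_mul_eval (0 : ℚ⟦X⟧)
        (Polynomial.C (C (x + x⁻¹)) * (1 + Polynomial.X ^ 2))
      have hY' : Y = X * C (x + x⁻¹) * (1 + Y ^ 2) := by
        conv_lhs => rw [hY]
        simp [mul_assoc]
      have hY0 : constantCoeff Y = 0 := by rw [hY']; simp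
      have e := h x hx Y hY'
      simp only [map_mul, map_pow, innerEval_X] at e
      have e' : C (x + x⁻¹) * (C x * innerEval (C x) G + C x⁻¹ * innerEval (C x⁻¹) G) =
          (1 + Y ^ 2) * innerEval Y G - innerEval 0 G := by
        apply mul_left_cancel₀ (pow_ne_zero n (X_ne_zero (R := ℚ)))
        linear_combination e
      have e'' := congrArg constantCoeff e'
      simp only [map_mul, map_add, map_sub, constantCoeff_innerEval, constantCoeff_C, hY0,
        map_pow, map_zero, map_one] at e''
      have hs : x + x⁻¹ ≠ 0 := by positivity
      apply mul_left_cancel₀ hs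
      rw [e'']; ring
    rw [pow_succ]
    exact mul_dvd_mul_left _ (X_dvd_iff.2 hG)

end Boundary

section Solution

open PowerSeries

theorem exists_theta : ∃ θ : ℚ⟦X⟧, constantCoeff θ = 0 ∧
    X ^ 2 * (1 + θ) ^ 6 * (1 - θ) ^ 2 = θ * (1 - θ + θ ^ 2) ^ 3 := by
  obtain ⟨τ, hτ⟩ := exists_eq_add_X_mul_eval (0 : ℚ⟦X⟧)
    ((1 + Polynomial.C X * Polynomial.X) ^ 6 * (1 - Polynomial.C X * Polynomial.X) ^ 2 +
      Polynomial.X ^ 2 * (1 - Polynomial.C X * Polynomial.X) *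
        (1 + (1 - Polynomial.C X * Polynomial.X + (Polynomial.C X * Polynomial.X) ^ 2) +
          (1 - Polynomial.C X * Polynomial.X + (Polynomial.C X * Polynomial.X) ^ 2) ^ 2))
  refine ⟨X * τ, by simp, ?_⟩
  simp only [Polynomial.eval_add, Polynomial.eval_mul, Polynomial.eval_sub, Polynomial.eval_pow,
    Polynomial.eval_one, Polynomial.eval_C, Polynomial.eval_X] at hτ
  linear_combination - X * hτ

theorem exists_curve (θ : ℚ⟦X⟧) (h0 : constantCoeff θ = 0) : ∃ E : (Polynomial ℚ)⟦X⟧,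
    constantCoeff E = 1 ∧ ∀ z : ℚ⟦X⟧, innerEval z E * (1 - θ + θ ^ 2 + θ ^ 3 * (z * innerEval z E) ^ 2) =
      1 + θ * (1 - θ + θ ^ 2) * (z * innerEval z E) ^ 2 := by
  obtain ⟨τ, rfl⟩ := X_dvd_iff.2 h0
  set T : (Polynomial ℚ)⟦X⟧ := PowerSeries.map Polynomial.C τ with hT
  obtain ⟨E, hE⟩ := exists_eq_add_X_mul_eval (1 : (Polynomial ℚ)⟦X⟧)
    (Polynomial.C (T * (1 - X * T + (X * T) ^ 2) * C Polynomial.X ^ 2) * Polynomial.X ^ 2 -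
      Polynomial.C (T * (X * T) ^ 2 * C Polynomial.X ^ 2) * Polynomial.X ^ 3 +
      Polynomial.C (T * (1 - X * T)) * Polynomial.X)
  refine ⟨E, by rw [hE]; simp, fun z => ?_⟩
  simp only [Polynomial.eval_add, Polynomial.eval_mul, Polynomial.eval_sub, Polynomial.eval_pow,
    Polynomial.eval_C, Polynomial.eval_X] at hE
  have h := congrArg (innerEval z) hE
  have hTz : innerEval z T = τ := by rw [hT, innerEval_map_C]
  have hx : innerEval z (C Polynomial.X) = z := by rw [innerEval_C, Polynomial.aeval_X]
  simp only [map_add, map_mul, map_sub, map_pow, map_one, innerEval_X, hTz, hx] at h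
  linear_combination h

theorem map_rowNum {A B : Type*} [CommRing A] [CommRing B] (e : A →+* B) (θ η : A) :
    e (rowNum θ η) = rowNum (e θ) (e η) := by
  simp [rowNum, map_ofNat]

theorem exists_boundary_model (θ : ℚ⟦X⟧) (h0 : constantCoeff θ = 0) (E : (Polynomial ℚ)⟦X⟧) :
    ∃ L : (Polynomial ℚ)⟦X⟧, ∀ z : ℚ⟦X⟧,
      3 * (1 - θ + θ ^ 2) ^ 3 * (1 + θ ^ 2 * (z * innerEval z E) ^ 2) ^ 2 *
          (1 + θ ^ 4 * (z * innerEval z E) ^ 2) ^ 2 * innerEval z L =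
        innerEval z E * (1 + θ) ^ 3 * (1 - θ) * rowNum θ (z * innerEval z E) := by
  set T : (Polynomial ℚ)⟦X⟧ := PowerSeries.map Polynomial.C θ with hT
  have hT0 : constantCoeff T = 0 := by
    rw [hT, ← coeff_zero_eq_constantCoeff_apply, coeff_map, coeff_zero_eq_constantCoeff_apply, h0,
      map_zero]
  set η : (Polynomial ℚ)⟦X⟧ := C Polynomial.X * E
  have hunit : IsUnit (3 * (1 - T + T ^ 2) ^ 3 * (1 + T ^ 2 * η ^ 2) ^ 2 *
      (1 + T ^ 4 * η ^ 2) ^ 2) := by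
    rw [isUnit_iff_constantCoeff]
    simp only [map_mul, map_add, map_sub, map_pow, map_one, hT0, map_ofNat]
    rw [show (3 * (1 - 0 + 0 ^ 2) ^ 3 * (1 + 0 ^ 2 * constantCoeff η ^ 2) ^ 2 *
      (1 + 0 ^ 4 * constantCoeff η ^ 2) ^ 2 : Polynomial ℚ) = Polynomial.C 3 by
        rw [map_ofNat]; ring]
    exact Polynomial.isUnit_C.2 (by norm_num)
  obtain ⟨L, hL⟩ := hunit.dvd (a := E * (1 + T) ^ 3 * (1 - T) * rowNum T η)
  refine ⟨L, fun z => ?_⟩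
  have h := congrArg (innerEval z) hL
  have hTz : innerEval z T = θ := by rw [hT, innerEval_map_C]
  have hη : innerEval z η = z * innerEval z E := by
    rw [map_mul, innerEval_C, Polynomial.aeval_X]
  simp only [map_add, map_mul, map_sub, map_pow, map_one, map_rowNum, map_ofNat, hTz, hη] at h
  exact h.symm

theorem ne_zero_of_constantCoeff {f : ℚ⟦X⟧} (h : constantCoeff f ≠ 0) : f ≠ 0 := by
  rintro rfl; simp at h

theorem isParam_of_series {K : Type*} [Field K] {ι : ℚ⟦X⟧ →+* K} (hinj : Function.Injective ι)
    {θ z ε Λ : ℚ⟦X⟧} (h0 : constantCoeff θ = 0) (hε : constantCoeff ε = 1)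
    (hz : z ≠ 0)
    (hcurve : ε * (1 - θ + θ ^ 2 + θ ^ 3 * (z * ε) ^ 2) = 1 + θ * (1 - θ + θ ^ 2) * (z * ε) ^ 2)
    (hvalue : 3 * (1 - θ + θ ^ 2) ^ 3 * (1 + θ ^ 2 * (z * ε) ^ 2) ^ 2 *
          (1 + θ ^ 4 * (z * ε) ^ 2) ^ 2 * Λ = ε * (1 + θ) ^ 3 * (1 - θ) * rowNum θ (z * ε)) :
    IsParam (ι θ) (ι z) (ι (z * ε))
      (ι (z * Λ)) := by
  have hne : ∀ f : ℚ⟦X⟧, f ≠ 0 → ι f ≠ 0 := fun f hf =>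
    (map_ne_zero_iff _ hinj).2 hf
  have hne' : ∀ f : ℚ⟦X⟧, constantCoeff f ≠ 0 → ι f ≠ 0 :=
    fun f hf => hne f (ne_zero_of_constantCoeff hf)
  constructor
  · have := congrArg (fun f => ι (z * f)) hcurve
    simp only [map_mul, map_add, map_sub, map_pow, map_one] at this ⊢
    linear_combination this
  · have := congrArg (fun f => ι (z * f)) hvalue
    simp only [map_mul, map_add, map_sub, map_pow, map_one, map_rowNum, map_ofNat] at this ⊢
    linear_combination this
  · exact hne _ (mul_ne_zero hz (ne_zero_of_constantCoeff (f := ε) (by simp [hε])))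
  · have h := hne' (1 + θ * (1 - θ + θ ^ 2) * (z * ε) ^ 2) (by simp [h0])
    simpa only [map_add, map_mul, map_sub, map_pow, map_one] using h
  · have h := hne' (1 - θ + θ ^ 2 + θ ^ 3 * (z * ε) ^ 2) (by simp [h0])
    simpa only [map_add, map_mul, map_sub, map_pow, map_one] using h
  · have h := hne' (1 + θ ^ 2 * (z * ε) ^ 2) (by simp [h0])
    simpa only [map_add, map_mul, map_sub, map_pow, map_one] using h
  · have hc : (1 : ℚ) + (constantCoeff z) ^ 2 ≠ 0 := by positivity
    have h := hne' (1 + (z * ε) ^ 2) (by simpa [hε] using hc)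
    simpa only [map_add, map_mul, map_sub, map_pow, map_one] using h
  · have h := hne' (1 + θ ^ 4 * (z * ε) ^ 2) (by simp [h0])
    simpa only [map_add, map_mul, map_sub, map_pow, map_one] using h

theorem model_kernel_equation {K : Type*} [Field K] {ι : ℚ⟦X⟧ →+* K}
    (hinj : Function.Injective ι) {θ Y ε₁ ε₂ ε₃ Λ₁ Λ₂ Λ₃ Λ₀ : ℚ⟦X⟧} {x : ℚ}
    (h0 : constantCoeff θ = 0)
    (hθ : X ^ 2 * (1 + θ) ^ 6 * (1 - θ) ^ 2 = θ * (1 - θ + θ ^ 2) ^ 3)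
    (hx : 1 < x) (hY : Y = X * C (x + x⁻¹) * (1 + Y ^ 2))
    (hε₁ : constantCoeff ε₁ = 1) (hε₂ : constantCoeff ε₂ = 1)
    (h₁ : IsParam (ι θ) (ι (C x))
      (ι (C x * ε₁)) (ι (C x * Λ₁)))
    (h₂ : IsParam (ι θ) (ι (C x⁻¹))
      (ι (C x⁻¹ * ε₂)) (ι (C x⁻¹ * Λ₂)))
    (h₃ : IsParam (ι θ) (ι Y)
      (ι (Y * ε₃)) (ι (Y * Λ₃)))
    (hΛ₀ : 3 * (1 - θ + θ ^ 2) ^ 3 * Λ₀ = (1 - θ - θ ^ 2 - θ ^ 3) * (1 + θ) ^ 3 * (1 - θ)) :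
    C (x + x⁻¹) * (C x * Λ₁ + C x⁻¹ * Λ₂) =
      (1 + Y ^ 2) * Λ₃ - Λ₀ + C (1 / 3) * C (x + x⁻¹) ^ 2 * (1 + Y ^ 2) := by
  have hne : ∀ f : ℚ⟦X⟧, f ≠ 0 → ι f ≠ 0 := fun f hf => (map_ne_zero_iff _ hinj).2 hf
  have hne' : ∀ f : ℚ⟦X⟧, constantCoeff f ≠ 0 → ι f ≠ 0 := fun f hf =>
    hne f (ne_zero_of_constantCoeff hf)
  have hne₂ : ∀ f g : ℚ⟦X⟧, constantCoeff f ≠ constantCoeff g → ι f ≠ ι g := fun f g hfg =>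
    hinj.ne (ne_of_apply_ne _ hfg)
  have hx0 : x ≠ 0 := by positivity
  have hY0 : constantCoeff Y = 0 := by rw [hY]; simp
  have hxx : ι (C x⁻¹) = (ι (C x))⁻¹ := by
    refine eq_inv_of_mul_eq_one_left ?_
    rw [← map_mul, ← map_mul, inv_mul_cancel₀ hx0, map_one, map_one]
  have hs : ι (C (x + x⁻¹)) = ι (C x) + (ι (C x))⁻¹ := by rw [map_add, map_add, hxx]
  have hs0 : ι (C (x + x⁻¹)) ≠ 0 := hne' _ (by simp only [constantCoeff_C]; positivity)
  have hYne : Y ≠ 0 := by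
    rintro rfl
    have : (x + x⁻¹ : ℚ) ≠ 0 := by positivity
    simp only [ne_eq, OfNat.ofNat_ne_zero, not_false_eq_true, zero_pow, add_zero, mul_one,
      zero_eq_mul, X_ne_zero, false_or] at hY
    exact this (by simpa using congrArg constantCoeff hY)
  have hθne : θ ≠ 0 := by
    rintro rfl
    simp at hθ
  have h3 : (3 : K) ≠ 0 := by
    have h := hne' 3 (by rw [map_ofNat]; norm_num)
    simpa only [map_ofNat] using h
  have hδ : ι (1 - θ + θ ^ 2) ≠ 0 := hne' _ (by simp [h0])
  rw [hxx] at h₂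
  have key := IsParam.kernel_identity (t := ι X) h3 h₁ h₂ h₃
    (by simpa only [map_add, map_mul, map_sub, map_pow, map_one] using congrArg ι hθ)
    (by have := congrArg ι hY
        simp only [map_mul, hs] at this
        simpa only [map_add, map_pow, map_one] using this)
    (hne _ X_ne_zero) (hne' _ (by simpa using hx0)) (hs ▸ hs0) (hne _ hYne) (hne _ hθne)
    (by have h := hne' (1 + θ) (by simp [h0])
        simpa only [map_add, map_one] using h)
    (by have h := hne' (1 - θ) (by simp [h0])
        simpa only [map_sub, map_one] using h)
    (by simpa only [map_add, map_sub, map_pow, map_one] using hδ)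
    (by
      have : x ^ 2 ≠ x⁻¹ ^ 2 := by
        have h1 : x⁻¹ < 1 := inv_lt_one_of_one_lt₀ hx
        have h2 : 0 < x⁻¹ := by positivity
        nlinarith
      have h := hne₂
        ((C x * ε₁) ^ 2 * (1 + θ ^ 2 * (C x⁻¹ * ε₂) ^ 2) ^ 2)
        ((C x⁻¹ * ε₂) ^ 2 * (1 + θ ^ 2 * (C x * ε₁) ^ 2) ^ 2) (by
          simpa only [map_add, map_mul, map_pow, map_one, h0, hε₁, hε₂, constantCoeff_C, mul_one,
            ne_eq, OfNat.ofNat_ne_zero, not_false_eq_true, zero_pow, zero_mul, add_zero, one_pow]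
            using this)
      simpa only [map_add, map_mul, map_sub, map_pow, map_one] using h)
    (by
      have h := hne₂
        (θ * (1 - θ) ^ 2 * (1 - θ ^ 2) ^ 4 * (C x * ε₁) ^ 2 * (Y * ε₃) ^ 2)
        ((1 - θ + θ ^ 2) * (1 + θ) ^ 2 * (1 + θ ^ 2 * (C x * ε₁) ^ 2) ^ 2 *
          (1 + θ ^ 2 * (Y * ε₃) ^ 2) ^ 2) (by simp [h0])
      simpa only [map_add, map_mul, map_sub, map_pow, map_one] using h)
    (by
      have h := hne₂
        (θ * (1 - θ) ^ 2 * (1 - θ ^ 2) ^ 4 * (C x⁻¹ * ε₂) ^ 2 * (Y * ε₃) ^ 2)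
        ((1 - θ + θ ^ 2) * (1 + θ) ^ 2 * (1 + θ ^ 2 * (C x⁻¹ * ε₂) ^ 2) ^ 2 *
          (1 + θ ^ 2 * (Y * ε₃) ^ 2) ^ 2) (by simp [h0])
      simpa only [map_add, map_mul, map_sub, map_pow, map_one] using h)
  have hΛ : ι Λ₀ = (1 - ι θ - ι θ ^ 2 - ι θ ^ 3) * (1 + ι θ) ^ 3 * (1 - ι θ) /
      (3 * (1 - ι θ + ι θ ^ 2) ^ 3) := by
    have := congrArg ι hΛ₀
    simp only [map_add, map_mul, map_sub, map_pow, map_one, map_ofNat] at this hδ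
    rw [eq_div_iff (mul_ne_zero h3 (pow_ne_zero _ hδ))]
    linear_combination this
  have hk : ι (C (1 / 3)) = 1 / 3 := by
    rw [eq_div_iff h3, show (3 : K) = ι (C 3) by rw [map_ofNat, map_ofNat],
      ← map_mul, ← map_mul]
    norm_num
  rw [← hΛ, map_mul ι Y Λ₃, mul_div_cancel_left₀ _ (hne _ hYne), ← hs] at key
  apply hinj
  simp only [map_mul ι, map_add ι, map_sub ι, map_pow ι, map_one ι, hk] at key ⊢
  linear_combination key

/-- The value at the origin of the boundary generating function. -/
theorem innerEval_zero_boundaryGF {θ : ℚ⟦X⟧} (h0 : constantCoeff θ = 0)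
    (hθ : X ^ 2 * (1 + θ) ^ 6 * (1 - θ) ^ 2 = θ * (1 - θ + θ ^ 2) ^ 3) :
    3 * (1 - θ + θ ^ 2) ^ 3 * innerEval 0 boundaryGF =
      (1 - θ - θ ^ 2 - θ ^ 3) * (1 + θ) ^ 3 * (1 - θ) := by
  obtain ⟨E, hE1, hE⟩ := exists_curve θ h0
  obtain ⟨L, hL⟩ := exists_boundary_model θ h0 E
  have hε : ∀ z : ℚ⟦X⟧, constantCoeff (innerEval z E) = 1 := fun z => by
    rw [constantCoeff_innerEval, hE1, Polynomial.eval_one]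
  have hinj := IsFractionRing.injective ℚ⟦X⟧ (FractionRing ℚ⟦X⟧)
  have hp : ∀ z : ℚ⟦X⟧, z ≠ 0 → _ := fun z hz => isParam_of_series hinj h0 (hε z) hz (hE z) (hL z)
  have hL0 : 3 * (1 - θ + θ ^ 2) ^ 3 * innerEval 0 L =
      (1 - θ - θ ^ 2 - θ ^ 3) * (1 + θ) ^ 3 * (1 - θ) := by
    have h₁ := hE 0
    have h₂ := hL 0
    rw [rowNum] at h₂
    linear_combination h₂ + (1 - θ - θ ^ 2 - θ ^ 3) * (1 + θ) ^ 3 * (1 - θ) * h₁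
  have hF : boundaryGF - L = 0 := by
    refine eq_zero_of_kernel_equation fun x hx Y hY => ?_
    have hx0 : x ≠ 0 := by positivity
    have hYne : Y ≠ 0 := by
      rintro rfl
      have : (x + x⁻¹ : ℚ) ≠ 0 := by positivity
      simp only [ne_eq, OfNat.ofNat_ne_zero, not_false_eq_true, zero_pow, add_zero, mul_one,
        zero_eq_mul, X_ne_zero, false_or] at hY
      exact this (by simpa using congrArg constantCoeff hY)
    have e₁ := boundaryGF_kernel_equation hx0 hY
    have e₂ := model_kernel_equation hinj h0 hθ hx hY (hε _) (hε _)
      (hp (C x) (by simpa using hx0)) (hp (C x⁻¹) (by simpa using hx0)) (hp Y hYne) hL0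
    simp only [map_sub]
    linear_combination e₁ - e₂
  rw [sub_eq_zero.1 hF, hL0]

theorem boxGF_coneC_origin :
    boxGF coneC (pt 0 : ℤ → ℚ⟦X⟧) (pt 0) =
      2 * innerEval 0 boundaryGF + C (1 / 3) * boxGF quadQ (pt 0) (pt 0) := by
  have e := boxGF_coneC_sub_mirror (R := ℚ) (g := pt 0) (h := pt 0)
    (fun i hi => if_neg hi.ne) (fun i hi => if_neg hi.ne)
  rw [mirror_pt, boxGF_swap swap_mem_coneC (pt 0) (pt (-0 - 2))] at e
  have h3 : (3 * C (1 / 3) : ℚ⟦X⟧) = 1 := by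
    rw [show (3 : ℚ⟦X⟧) = C 3 from rfl, ← map_mul]; norm_num
  rw [innerEval_boundaryGF, geo_zero, mirror_pt]
  linear_combination e - boxGF quadQ (pt 0 : ℤ → ℚ⟦X⟧) (pt 0) * h3

end Solution

section Counting

/-- The walks from `a` to `b` of length `n` with diagonal steps inside `S`. -/
def IsDiagWalk (S : Set (ℤ × ℤ)) (b : ℤ × ℤ) (n : ℕ) (a : ℤ × ℤ) (w : Fin (n + 1) → ℤ × ℤ) : Prop :=
  w 0 = a ∧ w (Fin.last n) = b ∧
    (∀ k : Fin n, w k.succ - w k.castSucc ∈ diagSteps) ∧ (∀ k, w k ∈ S)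

theorem isDiagWalk_cons {S : Set (ℤ × ℤ)} {a b : ℤ × ℤ} {n : ℕ} {v : Fin (n + 1) → ℤ × ℤ} :
    IsDiagWalk S b (n + 1) a (Fin.cons a v : Fin (n + 2) → ℤ × ℤ) ↔
      a ∈ S ∧ v 0 - a ∈ diagSteps ∧ IsDiagWalk S b n (v 0) v := by
  simp only [IsDiagWalk, Fin.forall_fin_succ (n := n), Fin.forall_fin_succ (n := n + 1),
    ← Fin.succ_last, Fin.cons_succ, Fin.cons_zero, Fin.castSucc_zero, ← Fin.succ_castSucc]
  tauto

theorem diagSteps_eq_coe :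
    diagSteps = (({(1, 1), (1, -1), (-1, 1), (-1, -1)} : Finset (ℤ × ℤ)) : Set (ℤ × ℤ)) := by
  simp [diagSteps]

/-- Walks of length `n + 1` decompose by their first step. -/
def diagWalkEquiv {S : Set (ℤ × ℤ)} {a : ℤ × ℤ} (ha : a ∈ S) (b : ℤ × ℤ) (n : ℕ)
    (s : diagSteps) :
    {w : {w // IsDiagWalk S b (n + 1) a w} // w.1 1 - a = s} ≃ {v // IsDiagWalk S b n (a + s) v} where
  toFun w := ⟨Fin.tail w.1.1, by
    obtain ⟨⟨w, hw⟩, hs⟩ := w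
    obtain rfl : w 0 = a := hw.1
    have hw' : IsDiagWalk S b (n + 1) (w 0) (Fin.cons (w 0) (Fin.tail w) : Fin (n + 2) → ℤ × ℤ) := by
      rwa [Fin.cons_self_tail]
    have : w 0 + s = Fin.tail w 0 := by rw [← hs]; simp [Fin.tail]
    rw [this]; exact (isDiagWalk_cons.1 hw').2.2⟩
  invFun v := ⟨⟨Fin.cons a v.1, by
    have h0 : v.1 0 = a + s := v.2.1
    rw [isDiagWalk_cons, h0, add_sub_cancel_left]
    exact ⟨ha, s.2, v.2⟩⟩, by
      have h0 : v.1 0 = a + s := v.2.1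
      change v.1 0 - a = s
      rw [h0, add_sub_cancel_left]⟩
  left_inv w := by
    obtain ⟨⟨w, hw⟩, hs⟩ := w
    obtain rfl : w 0 = a := hw.1
    exact Subtype.ext (Subtype.ext (Fin.cons_self_tail w))
  right_inv v := Subtype.ext (Fin.tail_cons (α := fun _ => ℤ × ℤ) a v.1)

theorem card_isDiagWalk (S : Set (ℤ × ℤ)) (b : ℤ × ℤ) (n : ℕ) (a : ℤ × ℤ) :
    Finite {w // IsDiagWalk S b n a w} ∧
      (Nat.card {w // IsDiagWalk S b n a w} : ℚ) =
        S.indicator ((diagStep S ^ n) fun p => if p = b then 1 else 0) a := by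
  by_cases ha : a ∈ S
  swap
  · have : IsEmpty {w // IsDiagWalk S b n a w} := ⟨fun w => ha (w.2.1 ▸ w.2.2.2.2 0)⟩
    exact ⟨inferInstance, by simp [ha]⟩
  rw [Set.indicator_of_mem ha]
  induction n generalizing a with
  | zero =>
    have hsub : Subsingleton {w // IsDiagWalk S b 0 a w} := ⟨fun v w => Subtype.ext <| by
      funext i; rw [Fin.fin_one_eq_zero i]; exact v.2.1.trans w.2.1.symm⟩
    refine ⟨inferInstance, ?_⟩
    rw [pow_zero, Module.End.one_apply]
    split_ifs with hab
    · have : Nonempty {w // IsDiagWalk S b 0 a w} :=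
        ⟨fun _ => a, rfl, hab, fun k => k.elim0, fun _ => ha⟩
      rw [Nat.card_unique, Nat.cast_one]
    · have : IsEmpty {w // IsDiagWalk S b 0 a w} := ⟨fun w => hab (w.2.1.symm.trans w.2.2.1)⟩
      simp
  | succ n ih =>
    set W := {w // IsDiagWalk S b (n + 1) a w}
    have hfib : ∀ q, Finite {w // IsDiagWalk S b n q w} ∧
        (Nat.card {w // IsDiagWalk S b n q w} : ℚ) =
          S.indicator ((diagStep S ^ n) fun p => if p = b then 1 else 0) q := fun q => by
      by_cases hq : q ∈ S
      · rw [Set.indicator_of_mem hq]; exact ih q hq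
      · have : IsEmpty {w // IsDiagWalk S b n q w} := ⟨fun w => hq (w.2.1 ▸ w.2.2.2.2 0)⟩
        exact ⟨inferInstance, by simp [hq]⟩
    let D : Finset (ℤ × ℤ) := {(1, 1), (1, -1), (-1, 1), (-1, -1)}
    have hD : ∀ s, s ∈ D ↔ s ∈ diagSteps := fun s => by rw [diagSteps_eq_coe]; rfl
    let f : W → D := fun w => ⟨w.1 1 - a, (hD _).2 (by
      have := w.2.2.2.1 0
      rwa [Fin.castSucc_zero, w.2.1] at this)⟩
    have e : ∀ s : D, {w // f w = s} ≃ {v // IsDiagWalk S b n (a + s) v} := fun s =>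
      (Equiv.subtypeEquivRight fun w => Subtype.ext_iff).trans
        (diagWalkEquiv ha b n ⟨s, (hD _).1 s.2⟩)
    have hfin : ∀ s : D, Finite {w // f w = s} := fun s =>
      have := (hfib (a + s)).1
      Finite.of_equiv _ (e s).symm
    refine ⟨Finite.of_equiv _ (Equiv.sigmaFiberEquiv f), ?_⟩
    rw [← Nat.card_congr (Equiv.sigmaFiberEquiv f), Nat.card_sigma, Nat.cast_sum,
      Finset.sum_congr rfl fun s _ => by rw [Nat.card_congr (e s), (hfib _).2],
      Finset.sum_coe_sort D fun s =>
        S.indicator ((diagStep S ^ n) fun p => if p = b then (1 : ℚ) else 0) (a + s),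
      pow_succ', Module.End.mul_apply, diagStep_apply]
    rw [Finset.sum_insert (by decide), Finset.sum_insert (by decide),
      Finset.sum_insert (by decide), Finset.sum_singleton]
    ring

open PowerSeries in
theorem coeff_walkGF_C {R : Type*} [CommRing R] (S : Set (ℤ × ℤ)) (w : ℤ × ℤ → R) (n : ℕ) :
    coeff n (walkGF S fun q => C (w q)) = (diagStep S ^ n) w 0 := by
  rw [walkGF_apply, xSum, coeff_mk, map_sum, Finset.sum_eq_single_of_mem n (by simp)]
  · rw [← map_diagStep_pow, coeff_X_pow_mul', if_pos le_rfl, Nat.sub_self,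
      coeff_zero_eq_constantCoeff_apply, constantCoeff_C]
  · intro k hk hkn
    have : ¬ n - k = 0 := by simp at hk; omega
    rw [← map_diagStep_pow, coeff_X_pow_mul', coeff_C, if_neg this, ite_self]

open PowerSeries in
theorem coeff_boxGF_pt {R : Type*} [CommRing R] (S : Set (ℤ × ℤ)) (n : ℕ) :
    coeff n (boxGF S (pt 0 : ℤ → R⟦X⟧) (pt 0)) =
      (diagStep S ^ n) (fun p => pt 0 p.1 * pt 0 p.2) 0 := by
  rw [boxGF_apply, ← coeff_walkGF_C]
  simp only [map_mul, map_pt]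

theorem walkCount_coneC (n : ℕ) :
    (walkCount diagSteps coneC (0, 0) (0, 0) n : ℚ) =
      PowerSeries.coeff n (boxGF coneC (pt 0 : ℤ → PowerSeries ℚ) (pt 0)) := by
  have h := (card_isDiagWalk coneC (0, 0) n (0, 0)).2
  rw [Set.indicator_of_mem (show (0, 0) ∈ coneC from zero_mem_coneC)] at h
  rw [coeff_boxGF_pt]
  have hw : (fun p : ℤ × ℤ => (pt 0 p.1 * pt 0 p.2 : ℚ)) = fun p => if p = (0, 0) then 1 else 0 := by
    funext p
    simp only [pt, Prod.ext_iff, ite_and, ite_mul, one_mul, zero_mul]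
  rw [hw]
  exact h

end Counting

section Ballot

theorem diagStep_quadQ_pow {A : Type*} [CommRing A] (n : ℕ) {f g : ℤ → A} (hf : ∀ i < 0, f i = 0)
    (hg : ∀ i < 0, g i = 0) (p : ℤ × ℤ) (hp : p ∈ quadQ) (hp' : Even (p.1 + p.2)) :
    (diagStep quadQ ^ n) (fun q => f q.1 * g q.2) p =
      (fun h => nonnegPart (shiftSum h))^[n] f p.1 * (fun h => nonnegPart (shiftSum h))^[n] g p.2 := by
  induction n generalizing f g p with
  | zero => rfl
  | succ n ih =>
    rw [pow_succ, Module.End.mul_apply, Function.iterate_succ_apply, Function.iterate_succ_apply,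
      ← ih (f := nonnegPart (shiftSum f)) (g := nonnegPart (shiftSum g))
        (fun i hi => if_neg hi.not_ge) (fun i hi => if_neg hi.not_ge) p hp hp']
    refine diagStep_pow_congr (fun q hq _ => ?_) n p hp hp'
    have hi : quadQ.indicator (fun p : ℤ × ℤ => f p.1 * g p.2) = fun p => f p.1 * g p.2 :=
      Set.indicator_eq_self.2 fun r hr => by
        by_contra h
        rcases not_and_or.1 h with h | h
        · exact hr (by simp only [hf _ (not_le.1 h), zero_mul])
        · exact hr (by simp only [hg _ (not_le.1 h), mul_zero])
    rw [diagStep_apply, hi, nonnegPart, nonnegPart, if_pos hq.1, if_pos hq.2, shiftSum_apply,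
      shiftSum_apply]
    simp only [Prod.fst_add, Prod.snd_add, sub_eq_add_neg]
    ring

/-- The ballot numbers. -/
theorem iterate_nonnegPart_pt (n : ℕ) :
    (∀ i : ℤ, i < 0 ∨ n < i → (fun h : ℤ → ℚ => nonnegPart (shiftSum h))^[n] (pt 0) i = 0) ∧
    ∀ m k : ℕ, n = 2 * m + k →
      ((m + k + 1).factorial * m.factorial : ℚ) *
        (fun h => nonnegPart (shiftSum h))^[n] (pt 0) k = (k + 1) * n.factorial := by
  induction n with
  | zero =>
    refine ⟨fun i hi => if_neg (by rintro rfl; simp at hi), fun m k h => ?_⟩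
    obtain rfl : m = 0 := by omega
    obtain rfl : k = 0 := by omega
    simp [pt]
  | succ n ih =>
    obtain ⟨ih₀, ih⟩ := ih
    simp only [Function.iterate_succ_apply']
    generalize (fun h : ℤ → ℚ => nonnegPart (shiftSum h))^[n] (pt 0) = a at *
    constructor
    · intro i hi
      rw [nonnegPart]
      split_ifs with h
      · rw [shiftSum_apply, ih₀ _ (by push_cast at hi; omega), ih₀ _ (by push_cast at hi; omega),
          add_zero]
      · rfl
    · intro m k hmk
      rw [nonnegPart, if_pos (Int.natCast_nonneg k), shiftSum_apply]
      have h₁ : ((m + k).factorial * m.factorial : ℚ) * a (k - 1) = k * n.factorial := by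
        rcases k with _ | k
        · rw [ih₀ _ (by simp)]; simp
        · have := ih m k (by omega)
          push_cast
          rw [add_sub_cancel_right]
          exact this
      have h₂ : ((m + k + 1).factorial * m.factorial : ℚ) * a (k + 1) =
          m * ((k + 2) * n.factorial) := by
        rcases m with _ | m
        · rw [ih₀ _ (by right; omega)]; simp
        · have := ih m (k + 1) (by omega)
          rw [show m + (k + 1) + 1 = m + 1 + k + 1 by ring] at this
          push_cast at this ⊢
          rw [Nat.factorial_succ m]
          push_cast
          linear_combination (m + 1 : ℚ) * this
      have h₃ : ((n : ℚ) + 1) = 2 * m + k := by exact_mod_cast hmk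
      have h₄ : ((m + k + 1).factorial : ℚ) = (m + k + 1) * (m + k).factorial := by
        rw [Nat.factorial_succ]; push_cast; ring
      rw [Nat.factorial_succ n]
      push_cast
      rw [h₃]
      linear_combination h₂ + (m + k + 1 : ℚ) * h₁ + m.factorial * a (k - 1) * h₄

theorem poch_succ (a : ℚ) (n : ℕ) : poch a (n + 1) = poch a n * (a + n) := by
  rw [poch, ascPochhammer_succ_eval, poch]

theorem poch_zero (a : ℚ) : poch a 0 = 1 := by simp [poch]

theorem poch_ne_zero {a : ℚ} (ha : 0 < a) (n : ℕ) : poch a n ≠ 0 :=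
  (ascPochhammer_pos n a ha).ne'

theorem poch_two (n : ℕ) : poch 2 n = (n + 1).factorial := by
  induction n with
  | zero => simp [poch_zero]
  | succ n ih => rw [poch_succ, ih, Nat.factorial_succ (n + 1)]; push_cast; ring

theorem poch_half (n : ℕ) : 4 ^ n * poch (1 / 2) n * n.factorial = (2 * n).factorial := by
  induction n with
  | zero => simp [poch_zero]
  | succ n ih =>
    rw [show 2 * (n + 1) = 2 * n + 1 + 1 by ring, Nat.factorial_succ (2 * n + 1),
      Nat.factorial_succ (2 * n), poch_succ, Nat.factorial_succ n]
    push_cast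
    rw [← ih]
    ring

theorem coeff_boxGF_quadQ (n : ℕ) :
    PowerSeries.coeff (2 * n) (boxGF quadQ (pt 0 : ℤ → PowerSeries ℚ) (pt 0)) =
      16 ^ n * poch (1 / 2) n ^ 2 / poch 2 n ^ 2 := by
  have hpt : ∀ i : ℤ, i < 0 → (pt 0 i : ℚ) = 0 := fun i hi => if_neg hi.ne
  rw [coeff_boxGF_pt, diagStep_quadQ_pow _ hpt hpt 0 zero_mem_quadQ (by simp)]
  have h := (iterate_nonnegPart_pt (2 * n)).2 n 0 rfl
  simp only [Prod.fst_zero, Prod.snd_zero]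
  rw [Nat.cast_zero] at h
  generalize (fun h : ℤ → ℚ => nonnegPart (shiftSum h))^[2 * n] (pt 0) 0 = a at *
  rw [← poch_half] at h
  have hn : (n.factorial : ℚ) ≠ 0 := by positivity
  have h2 := poch_ne_zero two_pos n
  have h' : poch 2 n * a = 4 ^ n * poch (1 / 2) n := by
    apply mul_right_cancel₀ hn
    rw [poch_two]
    simp only [add_zero, Nat.cast_zero, zero_add, one_mul] at h
    linear_combination h
  rw [eq_div_iff (pow_ne_zero 2 h2), show (16 : ℚ) ^ n = (4 ^ n) ^ 2 by
    rw [← pow_mul, mul_comm, pow_mul]; norm_num]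
  linear_combination (poch 2 n * a + 4 ^ n * poch (1 / 2) n) * h'

end Ballot

section Hypergeometric

variable {A : Type*} [CommRing A] [Algebra ℚ A] (D : Derivation ℚ A A) {θ F s : A}

theorem Derivation.map_numeral (n : ℕ) [n.AtLeastTwo] : D (OfNat.ofNat n : A) = 0 := by
  rw [← Nat.cast_ofNat]; exact D.map_natCast _

theorem Derivation.quotient_rule {Q R M N M' N' : A}
    (hM : D M = M' * D θ) (hN : D N = N' * D θ) (h : M * F = N) (hD : Q * D θ = R) :
    Q * M ^ 2 * D F = (M * N' - N * M') * R := by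
  have h' := congrArg D h
  simp only [Derivation.leibniz, hM, hN, smul_eq_mul] at h'
  linear_combination Q * M * h' - Q * M' * D θ * h + (M * N' - N * M') * hD

theorem Derivation.param_pole :
    D ((1 + θ) ^ 3 * (1 - θ)) = ((1 + θ) ^ 2 * (2 - 4 * θ)) * D θ := by
  simp only [Derivation.leibniz, Derivation.leibniz_pow, map_add, map_sub, D.map_one_eq_zero,
    smul_eq_mul, nsmul_eq_mul]
  push_cast
  ring

variable [IsDomain A]

theorem Derivation.param_eq
    (hs : D s = 2 * s) (hθ : s * (1 + θ) ^ 6 * (1 - θ) ^ 2 = θ * (1 - θ + θ ^ 2) ^ 3)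
    (h₁ : 1 + θ ≠ 0) (h₂ : 1 - θ ≠ 0) (h₃ : 1 - θ + θ ^ 2 ≠ 0) :
    (1 - 4 * θ + θ ^ 2) ^ 2 * D θ = 2 * θ * (1 - θ + θ ^ 2) * (1 - θ ^ 2) := by
  have h := congrArg D hθ
  simp only [Derivation.leibniz, Derivation.leibniz_pow, map_add, map_sub, D.map_one_eq_zero, hs,
    smul_eq_mul, nsmul_eq_mul] at h
  apply mul_left_cancel₀ (mul_ne_zero (mul_ne_zero (pow_ne_zero 5 h₁) h₂) (pow_ne_zero 2 h₃))
  push_cast at h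
  linear_combination -((1 + θ) ^ 6 * (1 - θ) ^ 2) * h +
    ((1 + θ) ^ 5 * (1 - θ) * (4 - 8 * θ) * D θ + 2 * ((1 + θ) ^ 6 * (1 - θ) ^ 2)) * hθ

theorem Derivation.ode_one
    (hs : s * (1 + θ) ^ 6 * (1 - θ) ^ 2 = θ * (1 - θ + θ ^ 2) ^ 3)
    (hD : (1 - 4 * θ + θ ^ 2) ^ 2 * D θ = 2 * θ * (1 - θ + θ ^ 2) * (1 - θ ^ 2))
    (hF : (1 + θ) ^ 3 * (1 - θ) * F = (1 - θ + θ ^ 2) ^ 2 + 3 * θ ^ 2)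
    (h₁ : 1 + θ ≠ 0) (h₂ : 1 - θ ≠ 0) (h₃ : 1 - 4 * θ + θ ^ 2 ≠ 0) :
    3 * D (D F) - 4 * D F = 16 * s * (3 * D (D F) - 2 * D F - F) := by
  have hP : (1 + θ) ^ 3 * (1 - θ) ≠ 0 := mul_ne_zero (pow_ne_zero 3 h₁) h₂
  have e₁ : (1 - 4 * θ + θ ^ 2) * ((1 + θ) ^ 3 * (1 - θ)) * D F =
      -8 * (θ * (1 - θ + θ ^ 2) ^ 2) := by
    apply mul_left_cancel₀ (mul_ne_zero h₃ hP)
    have h := D.quotient_rule (N' := 2 * (1 - θ + θ ^ 2) * (2 * θ - 1) + 6 * θ) D.param_pole (by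
      simp only [Derivation.leibniz, Derivation.leibniz_pow, map_add, map_sub, D.map_one_eq_zero,
        D.map_numeral, smul_eq_mul, nsmul_eq_mul]
      push_cast
      ring) hF hD
    linear_combination h
  have e₂ : (1 - 4 * θ + θ ^ 2) ^ 4 * ((1 + θ) ^ 3 * (1 - θ)) * D (D F) =
      -16 * θ * (1 - θ + θ ^ 2) ^ 2 *
        (1 - 5 * θ + 25 * θ ^ 2 - 46 * θ ^ 3 + 25 * θ ^ 4 - 5 * θ ^ 5 + θ ^ 6) := by
    apply mul_left_cancel₀ hP
    have h := D.quotient_rule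
      (M' := (2 * θ - 4) * ((1 + θ) ^ 3 * (1 - θ)) +
        (1 - 4 * θ + θ ^ 2) * ((1 + θ) ^ 2 * (2 - 4 * θ)))
      (N' := -8 * (1 - θ + θ ^ 2) ^ 2 - 16 * θ * (1 - θ + θ ^ 2) * (2 * θ - 1)) (by
        rw [Derivation.leibniz, D.param_pole]
        simp only [Derivation.leibniz, Derivation.leibniz_pow, map_add, map_sub, D.map_one_eq_zero,
          D.map_numeral, smul_eq_mul, nsmul_eq_mul]
        push_cast
        ring) (by
        simp only [Derivation.leibniz, Derivation.leibniz_pow, map_add, map_sub, map_neg,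
          D.map_one_eq_zero, D.map_numeral, smul_eq_mul, nsmul_eq_mul]
        push_cast
        ring) e₁ hD
    linear_combination h
  apply mul_left_cancel₀ (mul_ne_zero (pow_ne_zero 4 h₃) hP)
  linear_combination 3 * e₂ - 4 * (1 - 4 * θ + θ ^ 2) ^ 3 * e₁ -
    16 * s * (3 * e₂ - 2 * (1 - 4 * θ + θ ^ 2) ^ 3 * e₁ - (1 - 4 * θ + θ ^ 2) ^ 4 * hF) +
    16 * (1 + 10 * θ - 18 * θ ^ 2 + 10 * θ ^ 3 + θ ^ 4) * hs

theorem Derivation.ode_two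
    (hs : s * (1 + θ) ^ 6 * (1 - θ) ^ 2 = θ * (1 - θ + θ ^ 2) ^ 3)
    (hD : (1 - 4 * θ + θ ^ 2) ^ 2 * D θ = 2 * θ * (1 - θ + θ ^ 2) * (1 - θ ^ 2))
    (hF : (1 + θ) ^ 3 * (1 - θ) * F =
      (1 - θ + θ ^ 2) ^ 2 + 6 * θ * (1 - θ + θ ^ 2) - 3 * θ ^ 2)
    (h₁ : 1 + θ ≠ 0) (h₂ : 1 - θ ≠ 0) (h₃ : 1 - 4 * θ + θ ^ 2 ≠ 0) :
    3 * D (D F) - 2 * D F = 16 * s * (3 * D (D F) - 4 * D F + F) := by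
  have hP : (1 + θ) ^ 3 * (1 - θ) ≠ 0 := mul_ne_zero (pow_ne_zero 3 h₁) h₂
  have e₁ : (1 + θ) ^ 3 * (1 - θ) * D F = 4 * (θ * (1 - θ + θ ^ 2)) := by
    apply mul_left_cancel₀ (mul_ne_zero (pow_ne_zero 2 h₃) hP)
    have h := D.quotient_rule (N' := 2 * (1 - θ + θ ^ 2) * (2 * θ - 1) +
        6 * (1 - θ + θ ^ 2) + 6 * θ * (2 * θ - 1) - 6 * θ) D.param_pole (by
      simp only [Derivation.leibniz, Derivation.leibniz_pow, map_add, map_sub, D.map_one_eq_zero,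
        D.map_numeral, smul_eq_mul, nsmul_eq_mul]
      push_cast
      ring) hF hD
    linear_combination h
  have e₂ : (1 - 4 * θ + θ ^ 2) ^ 2 * ((1 + θ) ^ 3 * (1 - θ)) * D (D F) =
      8 * θ * (1 - θ + θ ^ 2) * (1 - 4 * θ + 8 * θ ^ 2 - 4 * θ ^ 3 + θ ^ 4) := by
    apply mul_left_cancel₀ hP
    have h := D.quotient_rule
      (N' := 4 * (1 - θ + θ ^ 2) + 4 * θ * (2 * θ - 1)) D.param_pole (by
        simp only [Derivation.leibniz, Derivation.leibniz_pow, map_add, map_sub,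
          D.map_one_eq_zero, D.map_numeral, smul_eq_mul, nsmul_eq_mul]
        push_cast
        ring) e₁ hD
    linear_combination h
  apply mul_left_cancel₀ (mul_ne_zero (pow_ne_zero 2 h₃) hP)
  linear_combination 3 * e₂ - 2 * (1 - 4 * θ + θ ^ 2) ^ 2 * e₁ -
    16 * s * (3 * e₂ - 4 * (1 - 4 * θ + θ ^ 2) ^ 2 * e₁ + (1 - 4 * θ + θ ^ 2) ^ 2 * hF) -
    16 * hs

end Hypergeometric

section Count

open PowerSeries

/-- The Euler derivation `X * d/dX`. -/
noncomputable def eulerD : Derivation ℚ ℚ⟦X⟧ ℚ⟦X⟧ := (X : ℚ⟦X⟧) • PowerSeries.derivative ℚ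

theorem coeff_eulerD (f : ℚ⟦X⟧) (n : ℕ) : coeff n (eulerD f) = n * coeff n f := by
  rw [eulerD, Derivation.smul_apply, smul_eq_mul]
  cases n with
  | zero => simp
  | succ n =>
    rw [coeff_succ_X_mul, coeff_derivative]
    push_cast
    ring

theorem eulerD_X_sq : eulerD (X ^ 2 : ℚ⟦X⟧) = 2 * X ^ 2 := by
  rw [eulerD, Derivation.smul_apply, Derivation.leibniz_pow, derivative_X]
  simp only [smul_eq_mul, nsmul_eq_mul]
  push_cast
  ring

theorem coeff_of_euler_ode {F : ℚ⟦X⟧} {a b c : ℚ}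
    (h : 3 * eulerD (eulerD F) - C a * eulerD F =
      16 * X ^ 2 * (3 * eulerD (eulerD F) - C b * eulerD F + C c * F)) (n : ℕ) :
    ((n : ℚ) + 2) * (3 * (n + 2) - a) * coeff (n + 2) F =
      16 * (3 * n ^ 2 - b * n + c) * coeff n F := by
  have h' := congrArg (coeff (n + 2)) h
  rw [show (16 : ℚ⟦X⟧) = C 16 from (map_ofNat C 16).symm,
    show (3 : ℚ⟦X⟧) = C 3 from (map_ofNat C 3).symm, mul_assoc, coeff_C_mul, coeff_X_pow_mul] at h'
  simp only [map_sub, map_add, coeff_C_mul, coeff_eulerD] at h'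
  push_cast at h'
  linear_combination h'

theorem poch_ratio_of_rec {u : ℕ → ℚ} {a b c : ℚ} (ha : 0 < a) (h0 : u 0 = c)
    (h : ∀ m : ℕ, ((m : ℚ) + 2) * (m + a) * u (m + 1) = 16 * (m + 1 / 2) * (m + b) * u m)
    (n : ℕ) : u n = c * (16 ^ n * (poch (1 / 2) n * poch b n) / (poch 2 n * poch a n)) := by
  induction n with
  | zero => simp [poch_zero, h0]
  | succ n ih =>
    have h₁ := poch_ne_zero (a := 2) (by norm_num) n
    have h₂ := poch_ne_zero ha n
    have h₃ : (n : ℚ) + 2 ≠ 0 := by positivity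
    have h₄ : (n : ℚ) + a ≠ 0 := by positivity
    have h₅ : u (n + 1) = 16 * (n + 1 / 2) * (n + b) * u n / ((n + 2) * (n + a)) := by
      rw [eq_div_iff (mul_ne_zero h₃ h₄), ← h]
      ring
    rw [h₅, ih]
    simp only [poch_succ]
    rw [add_comm (2 : ℚ) n, add_comm a n]
    field_simp
    ring

theorem exists_hypergeometric {θ : ℚ⟦X⟧} (h0 : constantCoeff θ = 0)
    (hθ : X ^ 2 * (1 + θ) ^ 6 * (1 - θ) ^ 2 = θ * (1 - θ + θ ^ 2) ^ 3) :
    ∃ F G : ℚ⟦X⟧,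
      (1 + θ) ^ 3 * (1 - θ) * F = (1 - θ + θ ^ 2) ^ 2 + 3 * θ ^ 2 ∧
      (1 + θ) ^ 3 * (1 - θ) * G =
        (1 - θ + θ ^ 2) ^ 2 + 6 * θ * (1 - θ + θ ^ 2) - 3 * θ ^ 2 ∧
      (∀ n, coeff (2 * n + 2) F =
        -4 * (16 ^ n * (poch (1 / 2) n * poch (7 / 6) n) / (poch 2 n * poch (4 / 3) n))) ∧
      ∀ n, coeff (2 * n + 2) G =
        2 * (16 ^ n * (poch (1 / 2) n * poch (5 / 6) n) / (poch 2 n * poch (5 / 3) n)) := by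
  have hP : IsUnit ((1 + θ) ^ 3 * (1 - θ)) := by
    rw [isUnit_iff_constantCoeff]
    simp [h0]
  obtain ⟨F, hF⟩ := hP.dvd (a := (1 - θ + θ ^ 2) ^ 2 + 3 * θ ^ 2)
  obtain ⟨G, hG⟩ := hP.dvd (a := (1 - θ + θ ^ 2) ^ 2 + 6 * θ * (1 - θ + θ ^ 2) - 3 * θ ^ 2)
  have h₁ : 1 + θ ≠ 0 := ne_zero_of_constantCoeff (by simp [h0])
  have h₂ : 1 - θ ≠ 0 := ne_zero_of_constantCoeff (by simp [h0])
  have h₃ : 1 - 4 * θ + θ ^ 2 ≠ 0 := ne_zero_of_constantCoeff (by simp [h0])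
  have hD := eulerD.param_eq eulerD_X_sq hθ h₁ h₂ (ne_zero_of_constantCoeff (by simp [h0]))
  have hF0 : coeff 0 F = 1 := by
    have h := congrArg constantCoeff hF
    simp only [map_add, map_sub, map_mul, map_pow, map_one, map_ofNat, h0] at h
    rw [coeff_zero_eq_constantCoeff_apply]
    linear_combination -h
  have hG0 : coeff 0 G = 1 := by
    have h := congrArg constantCoeff hG
    simp only [map_add, map_sub, map_mul, map_pow, map_one, map_ofNat, h0] at h
    rw [coeff_zero_eq_constantCoeff_apply]
    linear_combination -h
  have hF' := coeff_of_euler_ode (F := F) (a := 4) (b := 2) (c := -1) (by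
    rw [map_neg, map_ofNat, map_ofNat, map_one]
    linear_combination eulerD.ode_one hθ hD hF.symm h₁ h₂ h₃)
  have hG' := coeff_of_euler_ode (F := G) (a := 2) (b := 4) (c := 1) (by
    rw [map_ofNat, map_ofNat, map_one]
    linear_combination eulerD.ode_two hθ hD hG.symm h₁ h₂ h₃)
  refine ⟨F, G, hF.symm, hG.symm, fun n => ?_, fun n => ?_⟩
  · refine poch_ratio_of_rec (u := fun n => coeff (2 * n + 2) F) (by norm_num) ?_ (fun m => ?_) n
    · have h := hF' 0
      rw [hF0] at h
      norm_num at h ⊢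
      linarith
    · have h := hF' (2 * m + 2)
      rw [show 2 * m + 2 + 2 = 2 * (m + 1) + 2 by ring] at h
      push_cast at h
      linear_combination h / 12
  · refine poch_ratio_of_rec (u := fun n => coeff (2 * n + 2) G) (by norm_num) ?_ (fun m => ?_) n
    · have h := hG' 0
      rw [hG0] at h
      norm_num at h ⊢
      linarith
    · have h := hG' (2 * m + 2)
      rw [show 2 * m + 2 + 2 = 2 * (m + 1) + 2 by ring] at h
      push_cast at h
      linear_combination h / 12

theorem X_sq_mul_innerEval_boundaryGF {θ F G : ℚ⟦X⟧} (h0 : constantCoeff θ = 0)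
    (hθ : X ^ 2 * (1 + θ) ^ 6 * (1 - θ) ^ 2 = θ * (1 - θ + θ ^ 2) ^ 3)
    (hF : (1 + θ) ^ 3 * (1 - θ) * F = (1 - θ + θ ^ 2) ^ 2 + 3 * θ ^ 2)
    (hG : (1 + θ) ^ 3 * (1 - θ) * G =
      (1 - θ + θ ^ 2) ^ 2 + 6 * θ * (1 - θ + θ ^ 2) - 3 * θ ^ 2) :
    18 * (X ^ 2 * innerEval 0 boundaryGF) = 3 - 2 * F - G := by
  have h := innerEval_zero_boundaryGF h0 hθ
  have hP : (1 + θ) ^ 3 * (1 - θ) ≠ 0 := ne_zero_of_constantCoeff (by simp [h0])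
  have hδ : (1 - θ + θ ^ 2) ^ 3 ≠ 0 := ne_zero_of_constantCoeff (by simp [h0])
  apply mul_left_cancel₀ (mul_ne_zero hP hδ)
  linear_combination 6 * ((1 + θ) ^ 3 * (1 - θ)) * X ^ 2 * h +
    6 * (1 - θ - θ ^ 2 - θ ^ 3) * hθ + (1 - θ + θ ^ 2) ^ 3 * (2 * hF + hG)

end Count

theorem diag_threeQuadrant_origin_count (n : ℕ) :
    (walkCount diagSteps coneC (0, 0) (0, 0) (2*n) : ℚ) =
      16^n / 9 *
        (3 * (poch (1/2) n)^2 / (poch 2 n)^2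
          + 8 * (poch (1/2) n * poch (7/6) n) / (poch 2 n * poch (4/3) n)
          - 2 * (poch (1/2) n * poch (5/6) n) / (poch 2 n * poch (5/3) n)) := by
  obtain ⟨θ, h0, hθ⟩ := exists_theta
  obtain ⟨F, G, hF, hG, hFc, hGc⟩ := exists_hypergeometric h0 hθ
  have h := congrArg (PowerSeries.coeff (2 * n + 2)) (X_sq_mul_innerEval_boundaryGF h0 hθ hF hG)
  rw [show (18 : PowerSeries ℚ) = PowerSeries.C 18 from
      (map_ofNat PowerSeries.C 18).symm,
    show (3 : PowerSeries ℚ) = PowerSeries.C 3 from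
      (map_ofNat PowerSeries.C 3).symm,
    show (2 : PowerSeries ℚ) = PowerSeries.C 2 from
      (map_ofNat PowerSeries.C 2).symm, PowerSeries.coeff_C_mul, PowerSeries.coeff_X_pow_mul, map_sub,
    map_sub, PowerSeries.coeff_C_mul, hFc, hGc, PowerSeries.coeff_C, if_neg (by omega)] at h
  rw [walkCount_coneC, boxGF_coneC_origin, show (2 : PowerSeries ℚ) = PowerSeries.C 2 from
      (map_ofNat PowerSeries.C 2).symm,
    map_add, PowerSeries.coeff_C_mul, PowerSeries.coeff_C_mul, coeff_boxGF_quadQ]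
  linear_combination h / 9
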